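/- arXiv:2603.02827 — 7 statements merged into one kernel-verified Lean document; each statement's English description precedes it below -/
import Mathlib

section
/- Let G be a biconnected series-parallel simple graph with no transitive edges, let (s,t) be a separation pair of G, and let G' be a component of G with respect to (s,t). Then G' is critical if and only if G' is heavy. -/
open SimpleGraph

variable {V : Type*}

/-- A simple graph is biconnected if it has at least three vertices, is connected,
and deleting any single vertex leaves it connected. -/
def Biconnected [Fintype V] (G : SimpleGraph V) : Prop :=
  3 ≤ Fintype.card V ∧ G.Connected ∧ ∀ x : V, (G.induce {v | v ≠ x}).Connected

/-- `C` is the vertex set of a connected component of the subgraph of `G` induced by `D`: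
`C` is a nonempty subset of `D`, induces a connected graph, and is closed under
adjacency within `D`. -/
def IsCCOf (G : SimpleGraph V) (D C : Set V) : Prop :=
  C.Nonempty ∧ C ⊆ D ∧ (G.induce C).Connected ∧
    ∀ u ∈ C, ∀ w ∈ D, G.Adj u w → w ∈ C

/-- `(s, t)` is a separation pair: `s ≠ t` and `G - s - t` is disconnected. -/
def SepPair (G : SimpleGraph V) (s t : V) : Prop :=
  s ≠ t ∧ ¬ (G.induce {v | v ≠ s ∧ v ≠ t}).Preconnected

/-- `C` is the set of internal vertices of a component of `G` w.r.t. the separation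
pair `(s, t)`, i.e. the vertex set of a connected component of `G - s - t`.
(The component itself is the subgraph induced by `C ∪ {s, t}`.) -/
def IsCompAt (G : SimpleGraph V) (s t : V) (C : Set V) : Prop :=
  IsCCOf G {v | v ≠ s ∧ v ≠ t} C

/-- The component with internal vertices `C` and poles `s, t` is heavy if some internal
vertex is adjacent to neither `s` nor `t`. -/
def Heavy (G : SimpleGraph V) (s t : V) (C : Set V) : Prop :=
  ∃ v ∈ C, ¬ G.Adj v s ∧ ¬ G.Adj v t

/-- The component with internal vertices `C` and poles `s, t` is light if every internal
vertex is adjacent to `s` or to `t`. -/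
def Light (G : SimpleGraph V) (s t : V) (C : Set V) : Prop :=
  ∀ v ∈ C, G.Adj v s ∨ G.Adj v t

/-- `G` has no transitive edges: no edge joins the two vertices of a separation pair. -/
def NoTransitiveEdges (G : SimpleGraph V) : Prop :=
  ∀ s t : V, SepPair G s t → ¬ G.Adj s t

/-- The internal vertices of a walk: its support minus the two endpoints. -/
def interiorSet {G : SimpleGraph V} {u v : V} (w : G.Walk u v) : Set V :=
  {x | x ∈ w.support ∧ x ≠ u ∧ x ≠ v}

/-- `G` contains a subdivision of `K₄`: four distinct vertices joined pairwise by six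
paths that are pairwise internally disjoint and whose internal vertices avoid the four
branch vertices. -/
def ContainsK4Subdivision (G : SimpleGraph V) : Prop :=
  ∃ (a b c d : V) (pab : G.Walk a b) (pac : G.Walk a c) (pad : G.Walk a d)
    (pbc : G.Walk b c) (pbd : G.Walk b d) (pcd : G.Walk c d),
    ([a, b, c, d] : List V).Nodup ∧
    pab.IsPath ∧ pac.IsPath ∧ pad.IsPath ∧
    pbc.IsPath ∧ pbd.IsPath ∧ pcd.IsPath ∧
    ([interiorSet pab, interiorSet pac, interiorSet pad,
      interiorSet pbc, interiorSet pbd, interiorSet pcd]).Pairwise Disjoint ∧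
    ∀ I ∈ [interiorSet pab, interiorSet pac, interiorSet pad,
      interiorSet pbc, interiorSet pbd, interiorSet pcd],
      ∀ x ∈ I, x ∉ ({a, b, c, d} : Set V)

/-- The component with internal vertices `C` and poles `s, t` is critical: it has an
internal vertex `v` adjacent to neither `s` nor `t`, together with an `s`-`t` path in
the component through `v` such that no internal vertex of the subpath from `s` to `v`
is adjacent to `t` and no internal vertex of the subpath from `v` to `t` is adjacent
to `s`. -/
def Critical [DecidableEq V] (G : SimpleGraph V) (s t : V) (C : Set V) : Prop :=
  ∃ v ∈ C, ¬ G.Adj v s ∧ ¬ G.Adj v t ∧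
    ∃ (w : G.Walk s t) (_hp : w.IsPath) (hv : v ∈ w.support),
      (∀ x ∈ w.support, x = s ∨ x = t ∨ x ∈ C) ∧
      (∀ x ∈ (w.takeUntil v hv).support, x ≠ s → x ≠ v → ¬ G.Adj x t) ∧
      (∀ x ∈ (w.dropUntil v hv).support, x ≠ v → x ≠ t → ¬ G.Adj x s)

theorem lastExit {W : Type*} {H : SimpleGraph W} (S : Set W) {u v : W} (w : H.Walk u v) :
    (∃ x ∈ w.support, x ∈ S) → ∃ z ∈ S, ∃ w' : H.Walk z v, w'.support ⊆ w.support ∧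
      ∀ x ∈ w'.support, x ∈ S → x = z := by
  induction w with
  | nil =>
    rintro ⟨x, hx, hxS⟩
    simp at hx
    subst hx
    exact ⟨x, hxS, .nil, by simp, by simp⟩
  | @cons u m v h p ih =>
    intro hx
    by_cases hp : ∃ x ∈ p.support, x ∈ S
    · obtain ⟨z, hz, w', h1, h2⟩ := ih hp
      exact ⟨z, hz, w', fun y hy => by simp [h1 hy], h2⟩
    · push Not at hp
      obtain ⟨x, hx, hxS⟩ := hx
      rw [Walk.support_cons, List.mem_cons] at hx
      rcases hx with rfl | hx
      · refine ⟨x, hxS, .cons h p, by simp, ?_⟩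
        intro y hy hyS
        rw [Walk.support_cons, List.mem_cons] at hy
        rcases hy with rfl | hy
        · rfl
        · exact absurd hyS (hp y hy)
      · exact absurd hxS (hp x hx)

theorem menger2_step {W : Type*} (H : SimpleGraph W) (A B : Set W)
    (hcut : ∀ c, ∃ a ∈ A, ∃ b ∈ B, ∃ w : H.Walk a b, c ∉ w.support) (u w : W) (h : H.Adj u w)
    (hu : ∃ a ∈ A, ∃ a' ∈ A, ∃ b ∈ B, ∃ (p : H.Walk a u) (q : H.Walk a' b),
      ∀ z ∈ p.support, z ∉ q.support) :
    ∃ a ∈ A, ∃ a' ∈ A, ∃ b ∈ B, ∃ (p : H.Walk a w) (q : H.Walk a' b),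
      ∀ z ∈ p.support, z ∉ q.support := by
  classical
  obtain ⟨a, ha, a', ha', b, hb, p, q0, hd0⟩ := hu
  obtain ⟨q, hq, hd⟩ : ∃ q : H.Walk a' b, q.IsPath ∧ ∀ z ∈ p.support, z ∉ q.support :=
    ⟨q0.bypass, q0.bypass_isPath, fun z hz hz' => hd0 z hz (q0.support_bypass_subset_support hz')⟩
  by_cases hw : w ∈ q.support
  · set q1 := q.takeUntil w hw with hq1
    have hq1s : q1.support ⊆ q.support := q.support_takeUntil_subset_support hw
    have hq1p : q1.IsPath := hq.takeUntil hw
    obtain ⟨a2, ha2, b2, hb2, X, hX⟩ := hcut w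
    by_cases hm : ∃ x ∈ X.support, x ∈ ({x | x ∈ p.support ∨ x ∈ q1.support} : Set W)
    · obtain ⟨z, hz, X', hX', hX2⟩ := lastExit _ X hm
      rcases hz with hz | hz
      · refine ⟨a', ha', a, ha, b2, hb2, q1, (p.takeUntil z hz).append X', ?_⟩
        intro x hx hx'
        rw [Walk.mem_support_append_iff] at hx'
        rcases hx' with hx' | hx'
        · exact hd x (p.support_takeUntil_subset_support hz hx') (hq1s hx)
        · have := hX2 x hx' (Or.inr hx)
          subst this
          exact hd x hz (hq1s hx)
      · have hzw : z ≠ w := by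
          rintro rfl
          exact hX (hX' X'.start_mem_support)
        refine ⟨a, ha, a', ha', b2, hb2, p.concat h, (q1.takeUntil z hz).append X', ?_⟩
        intro x hx hx'
        rw [Walk.support_concat] at hx
        simp at hx
        rw [Walk.mem_support_append_iff] at hx'
        rcases hx with hx | rfl
        · rcases hx' with hx' | hx'
          · exact hd x hx (hq1s (q1.support_takeUntil_subset_support hz hx'))
          · have := hX2 x hx' (Or.inl hx)
            subst this
            exact hd x hx (hq1s hz)
        · rcases hx' with hx' | hx'
          · exact Walk.endpoint_notMem_support_takeUntil hq1p hz hzw.symm hx'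
          · exact hX (hX' hx')
    · push Not at hm
      refine ⟨a', ha', a2, ha2, b2, hb2, q1, X, ?_⟩
      intro x hx hx'
      exact hm x hx' (Or.inr hx)
  · refine ⟨a, ha, a', ha', b, hb, p.concat h, q, ?_⟩
    intro z hz
    rw [Walk.support_concat] at hz
    simp at hz
    rcases hz with hz | rfl
    · exact hd z hz
    · exact hw

theorem menger2 {W : Type*} (H : SimpleGraph W) (A B : Set W) (hcon : H.Preconnected)
    (hcut : ∀ c, ∃ a ∈ A, ∃ b ∈ B, ∃ w : H.Walk a b, c ∉ w.support) (hB : B.Nonempty) :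
    ∃ a ∈ A, ∃ a' ∈ A, ∃ b ∈ B, ∃ b' ∈ B, ∃ (p : H.Walk a b) (q : H.Walk a' b'),
      ∀ z ∈ p.support, z ∉ q.support := by
  obtain ⟨x, hx⟩ := hB
  obtain ⟨a0, ha0, -⟩ := hcut x
  have key : ∀ u v : W, H.Walk u v → (∃ a ∈ A, ∃ a' ∈ A, ∃ b ∈ B, ∃ (p : H.Walk a u)
      (q : H.Walk a' b), ∀ z ∈ p.support, z ∉ q.support) →
      (∃ a ∈ A, ∃ a' ∈ A, ∃ b ∈ B, ∃ (p : H.Walk a v) (q : H.Walk a' b),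
        ∀ z ∈ p.support, z ∉ q.support) := by
    intro u v w
    induction w with
    | nil => exact id
    | cons h p ih => exact fun hu => ih (menger2_step H A B hcut _ _ h hu)
  obtain ⟨w⟩ := hcon a0 x
  obtain ⟨a1, ha1, b1, hb1, w1, hw1⟩ := hcut a0
  obtain ⟨a, ha, a', ha', b, hb, p, q, hd⟩ := key a0 x w
    ⟨a0, ha0, a1, ha1, b1, hb1, .nil, w1, by simpa using hw1⟩
  exact ⟨a, ha, a', ha', x, hx, b, hb, p, q, hd⟩

theorem take_drop_disj {W : Type*} [DecidableEq W] {H : SimpleGraph W} {a b x : W}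
    (p : H.Walk a b) (hp : p.IsPath) (hx : x ∈ p.support) (y : W)
    (h1 : y ∈ (p.takeUntil x hx).support) (h2 : y ∈ (p.dropUntil x hx).support) : y = x := by
  have h := hp
  rw [← p.take_spec hx] at h
  by_contra hne
  rw [Walk.isPath_def, Walk.support_append] at h
  have h3 := (List.nodup_append.mp h).2.2 y h1
  rw [Walk.mem_support_iff] at h2
  rcases h2 with h2 | h2
  · exact hne h2
  · exact h3 y h2 rfl

theorem k4_build (G : SimpleGraph V) (C : Set V) {s t a b a' b' x y : V} (hst : s ≠ t)
    (hs : s ∉ C) (ht : t ∉ C) (o : G.Walk s t) (ho : o.IsPath)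
    (hoC : ∀ z ∈ o.support, z ∉ C)
    (p : G.Walk a b) (hp : p.IsPath) (hpC : ∀ z ∈ p.support, z ∈ C)
    (q : G.Walk a' b') (hq : q.IsPath) (hqC : ∀ z ∈ q.support, z ∈ C)
    (hd : ∀ z ∈ p.support, z ∉ q.support)
    (r : G.Walk x y) (hr : r.IsPath) (hrC : ∀ z ∈ r.support, z ∈ C)
    (hx : x ∈ p.support) (hy : y ∈ q.support)
    (hrp : ∀ z ∈ r.support, z ∈ p.support → z = x)
    (hrq : ∀ z ∈ r.support, z ∈ q.support → z = y)
    (hsa : G.Adj s a) (hsa' : G.Adj s a') (htb : G.Adj t b) (htb' : G.Adj t b') :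
    ContainsK4Subdivision G := by
  classical
  have hxC := hpC x hx
  have hyC := hqC y hy
  have hxy : x ≠ y := fun e => hd x hx (e ▸ hy)
  have sub1 := p.support_takeUntil_subset_support hx
  have sub2 := p.support_dropUntil_subset_support hx
  have sub3 := q.support_takeUntil_subset_support hy
  have sub4 := q.support_dropUntil_subset_support hy
  have td1 := take_drop_disj p hp hx
  have td2 := take_drop_disj q hq hy
  refine ⟨s, t, x, y, o, .cons hsa (p.takeUntil x hx), .cons hsa' (q.takeUntil y hy),
    .cons htb (p.dropUntil x hx).reverse, .cons htb' (q.dropUntil y hy).reverse, r, ?_, ho, ?_, ?_,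
    ?_, ?_, hr, ?_, ?_⟩
  · have : s ≠ x := fun e => hs (e ▸ hxC)
    have : s ≠ y := fun e => hs (e ▸ hyC)
    have : t ≠ x := fun e => ht (e ▸ hxC)
    have : t ≠ y := fun e => ht (e ▸ hyC)
    simp [*]
  · exact (hp.takeUntil hx).cons (fun h => hs (hpC _ (sub1 h)))
  · exact (hq.takeUntil hy).cons (fun h => hs (hqC _ (sub3 h)))
  · exact (hp.dropUntil hx).reverse.cons (fun h => ht (hpC _ (sub2 (by simpa using h))))
  · exact (hq.dropUntil hy).reverse.cons (fun h => ht (hqC _ (sub4 (by simpa using h))))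
  · simp only [List.pairwise_cons, List.mem_cons, List.not_mem_nil, or_false, forall_eq_or_imp,
      forall_eq, Set.disjoint_left, interiorSet, Set.mem_ofPred_eq, Walk.support_cons,
      Walk.support_reverse, List.mem_reverse]
    refine ⟨⟨?_, ?_, ?_, ?_, ?_⟩, ⟨?_, ?_, ?_, ?_⟩, ⟨?_, ?_, ?_⟩, ⟨?_, ?_⟩, ?_, ?_⟩ <;> grind
  · simp only [List.mem_cons, List.not_mem_nil, or_false, forall_eq_or_imp,
      forall_eq, interiorSet, Set.mem_ofPred_eq, Walk.support_cons,
      Walk.support_reverse, List.mem_reverse, Set.mem_insert_iff, Set.mem_singleton_iff]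
    refine ⟨?_, ?_, ?_, ?_, ?_, ?_⟩ <;> grind

theorem conn_walk {G : SimpleGraph V} {C : Set V} (h : (G.induce C).Preconnected) {u v : V}
    (hu : u ∈ C) (hv : v ∈ C) : ∃ w : G.Walk u v, w.IsPath ∧ ∀ x ∈ w.support, x ∈ C := by
  classical
  obtain ⟨w⟩ := h ⟨u, hu⟩ ⟨v, hv⟩
  let w' : G.Walk u v := w.map (Embedding.induce C).toHom
  have hw' : ∀ x ∈ w'.support, x ∈ C := by
    intro x hx
    have hx2 : x ∈ (w.map (Embedding.induce (G := G) C).toHom).support := hx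
    rw [Walk.support_map, List.mem_map] at hx2
    obtain ⟨y, -, rfl⟩ := hx2
    exact y.2
  exact ⟨w'.bypass, w'.bypass_isPath, fun x hx => hw' x (w'.support_bypass_subset_support hx)⟩

theorem closed_walk {G : SimpleGraph V} {D K : Set V}
    (hcl : ∀ u ∈ K, ∀ w ∈ D, G.Adj u w → w ∈ K) {u v : V} (w : G.Walk u v) :
    (∀ x ∈ w.support, x ∈ D) → u ∈ K → ∀ x ∈ w.support, x ∈ K := by
  induction w with
  | nil =>
    intro _ hu x hx
    simp at hx
    exact hx ▸ hu
  | @cons u m v h p ih =>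
    intro hD hu x hx
    rw [Walk.support_cons, List.mem_cons] at hx
    rcases hx with rfl | hx
    · exact hu
    · exact ih (fun y hy => hD y (by simp [hy])) (hcl u hu m (hD m (by simp)) h) x hx

theorem cc_exists (G : SimpleGraph V) {D : Set V} {d : V} (hd : d ∈ D) :
    ∃ K, IsCCOf G D K ∧ d ∈ K := by
  classical
  have hdK : d ∈ ({w | ∃ p : G.Walk d w, ∀ x ∈ p.support, x ∈ D} : Set V) :=
    ⟨.nil, by simpa using hd⟩
  refine ⟨{w | ∃ p : G.Walk d w, ∀ x ∈ p.support, x ∈ D}, ⟨⟨d, hdK⟩, ?_, ?_, ?_⟩, hdK⟩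
  · rintro w ⟨p, hp⟩
    exact hp w p.end_mem_support
  · refine induce_connected_of_patches d hdK ?_
    rintro v ⟨p, hp⟩
    refine ⟨{x | x ∈ p.support}, ?_, p.start_mem_support, p.end_mem_support,
      p.connected_induce_support.preconnected _ _⟩
    intro x hx
    exact ⟨p.takeUntil x hx, fun y hy => hp y (p.support_takeUntil_subset_support hx hy)⟩
  · rintro u ⟨p, hp⟩ w hw huw
    refine ⟨p.concat huw, ?_⟩
    intro x hx
    rw [Walk.support_concat] at hx
    simp at hx
    rcases hx with hx | rfl
    · exact hp x hx
    · exact hw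

theorem IsCompAt.symm {G : SimpleGraph V} {s t : V} {C : Set V} (h : IsCompAt G s t C) :
    IsCompAt G t s C := by
  have : ({v | v ≠ s ∧ v ≠ t} : Set V) = {v | v ≠ t ∧ v ≠ s} := by
    ext v
    exact and_comm
  unfold IsCompAt at *
  rwa [← this]

theorem SepPair.symm {G : SimpleGraph V} {s t : V} (h : SepPair G s t) : SepPair G t s := by
  have : ({v | v ≠ s ∧ v ≠ t} : Set V) = {v | v ≠ t ∧ v ≠ s} := by
    ext v
    exact and_comm
  unfold SepPair at *
  rw [← this]
  exact ⟨h.1.symm, h.2⟩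

theorem attach [Fintype V] {G : SimpleGraph V} (hBi : Biconnected G) {x y : V} (hxy : x ≠ y)
    {K : Set V} (hK : IsCompAt G x y K) : ∃ u ∈ K, G.Adj u x := by
  by_contra hno
  push Not at hno
  obtain ⟨⟨k, hk⟩, hsub, -, hcl⟩ := hK
  obtain ⟨w, -, hw⟩ := conn_walk (hBi.2.2 y).preconnected (u := k) (v := x) (hsub hk).2 hxy
  have := closed_walk (D := {v | v ≠ y}) (K := K) (fun u hu z hz huz =>
    hcl u hu z ⟨by rintro rfl; exact hno u hu huz, hz⟩ huz) w hw hk x w.end_mem_support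
  exact (hsub this).1 rfl

theorem sepPair_of {G : SimpleGraph V} {x y z : V} (hxy : x ≠ y)
    {K : Set V} (hK : IsCompAt G x y K) (hz : z ∉ K) (hzx : z ≠ x) (hzy : z ≠ y) :
    SepPair G x y := by
  refine ⟨hxy, fun hpre => ?_⟩
  obtain ⟨⟨k, hk⟩, hsub, -, hcl⟩ := hK
  obtain ⟨w, -, hw⟩ := conn_walk hpre (u := k) (v := z) (hsub hk) ⟨hzx, hzy⟩
  exact hz (closed_walk hcl w hw hk z w.end_mem_support)

/-- `c` separates `s` from `t` inside `C`. -/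
def Cuts (G : SimpleGraph V) (s t : V) (C : Set V) (c : V) : Prop :=
  c ∈ C ∧ ∀ (a b : V) (w : G.Walk a b), G.Adj a s → G.Adj b t → (∀ x ∈ w.support, x ∈ C) →
    c ∈ w.support

theorem Cuts.symm {G : SimpleGraph V} {s t : V} {C : Set V} {c : V} (h : Cuts G s t C c) :
    Cuts G t s C c := by
  refine ⟨h.1, fun a b w ha hb hw => ?_⟩
  have := h.2 b a w.reverse hb ha (by simpa using hw)
  simpa using this

theorem cut_exists [Fintype V] {G : SimpleGraph V} (hBi : Biconnected G)
    (hSP : ¬ ContainsK4Subdivision G) {s t : V} (hst : SepPair G s t) {C : Set V}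
    (hC : IsCompAt G s t C) : ∃ c, Cuts G s t C c := by
  classical
  by_contra hno
  have hsC : s ∉ C := fun h => (hC.2.1 h).1 rfl
  have htC : t ∉ C := fun h => (hC.2.1 h).2 rfl
  apply hSP
  -- other component
  obtain ⟨d, hdD, hdC⟩ : ∃ d ∈ ({v | v ≠ s ∧ v ≠ t} : Set V), d ∉ C := by
    by_contra hall
    push Not at hall
    have : C = ({v | v ≠ s ∧ v ≠ t} : Set V) := Set.Subset.antisymm hC.2.1 hall
    exact hst.2 (this ▸ hC.2.2.1.preconnected)
  obtain ⟨K, hK, hdK⟩ := cc_exists G hdD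
  have hKC : ∀ x ∈ K, x ∉ C := by
    intro x hx hxC
    obtain ⟨w, -, hw⟩ := conn_walk hK.2.2.1.preconnected hx hdK
    exact hdC (closed_walk hC.2.2.2 w (fun y hy => hK.2.1 (hw y hy)) hxC d w.end_mem_support)
  obtain ⟨u1, hu1, hu1s⟩ := attach hBi hst.1 hK
  obtain ⟨u2, hu2, hu2t⟩ := attach hBi hst.1.symm (IsCompAt.symm hK)
  obtain ⟨w0, -, hw0⟩ := conn_walk hK.2.2.1.preconnected hu1 hu2
  obtain ⟨o, ho, hoC⟩ : ∃ o : G.Walk s t, o.IsPath ∧ ∀ z ∈ o.support, z ∉ C := by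
    let o : G.Walk s t := .cons hu1s.symm (w0.concat hu2t)
    refine ⟨o.bypass, o.bypass_isPath, fun z hz => ?_⟩
    have hz := o.support_bypass_subset_support hz
    simp only [o, Walk.support_cons, Walk.support_concat, List.mem_cons, List.mem_append,
      List.not_mem_nil, or_false] at hz
    rcases hz with rfl | hz | rfl
    · exact hsC
    · exact hKC z (hw0 z hz)
    · exact htC
  -- Menger
  obtain ⟨b0, hb0, hb0t⟩ := attach hBi hst.1.symm hC.symm
  let f := (Embedding.induce (G := G) C).toHom
  have hf : ∀ x : C, f x = x.1 := fun x => rfl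
  have hfi : Function.Injective f := (Embedding.induce (G := G) C).injective
  obtain ⟨a, ha, a', ha', b, hb, b', hb', p, q, hd⟩ := menger2 (G.induce C) {x | G.Adj x.1 s}
    {x | G.Adj x.1 t} hC.2.2.1.preconnected (by
      intro c
      have : ¬ Cuts G s t C c := fun h => hno ⟨c, h⟩
      unfold Cuts at this
      push Not at this
      obtain ⟨a, b, w, ha, hb, hw, hc⟩ := this c.2
      have := w.start_mem_support
      have := w.end_mem_support
      refine ⟨⟨a, hw a (by simp)⟩, ha, ⟨b, hw b (by simp)⟩, hb, w.induce C hw, ?_⟩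
      intro hcs
      apply hc
      have h3 := List.mem_map_of_mem (f := Subtype.val) hcs
      rw [Walk.support_induce] at h3
      simpa using h3) ⟨⟨b0, hb0⟩, hb0t⟩
  have toG : ∀ {u v : C} (w : (G.induce C).Walk u v), ∃ w' : G.Walk u.1 v.1, w'.IsPath ∧
      ∀ z ∈ w'.support, ∃ hz : z ∈ C, (⟨z, hz⟩ : C) ∈ w.support := by
    intro u v w
    let w' : G.Walk u.1 v.1 := w.map f
    refine ⟨w'.bypass, w'.bypass_isPath, fun z hz => ?_⟩
    have hz2 : z ∈ (w.map f).support := w'.support_bypass_subset_support hz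
    rw [Walk.support_map, List.mem_map] at hz2
    obtain ⟨y, hy, rfl⟩ := hz2
    exact ⟨y.2, hy⟩
  obtain ⟨p', hp', hpw⟩ := toG p
  obtain ⟨q', hq', hqw⟩ := toG q
  obtain ⟨r0, -, hr0⟩ := conn_walk hC.2.2.1.preconnected a.2 a'.2
  obtain ⟨x, hx, r1, hr1, hr1x⟩ := lastExit {z | z ∈ p'.support} r0
    ⟨a, r0.start_mem_support, p'.start_mem_support⟩
  obtain ⟨y, hy, r2, hr2, hr2y⟩ := lastExit {z | z ∈ q'.support} r1.reverse
    ⟨a', r1.reverse.start_mem_support, q'.start_mem_support⟩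
  have hsub : ∀ z ∈ r2.reverse.bypass.support, z ∈ r2.support := by
    intro z hz
    simpa using r2.reverse.support_bypass_subset_support hz
  have hsub1 : ∀ z ∈ r2.reverse.bypass.support, z ∈ r1.support := by
    intro z hz
    simpa using hr2 (hsub z hz)
  exact k4_build G C hst.1 hsC htC o ho hoC p' hp' (fun z hz => (hpw z hz).1)
    q' hq' (fun z hz => (hqw z hz).1)
    (fun z hz hz' => hd _ (hpw z hz).2 (hqw z hz').2)
    r2.reverse.bypass r2.reverse.bypass_isPath (fun z hz => hr0 z (hr1 (hsub1 z hz))) hx hy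
    (fun z hz hzp => hr1x z (hsub1 z hz) hzp)
    (fun z hz hzq => hr2y z (hsub z hz) hzq) ha.symm ha'.symm hb.symm hb'.symm

/-- A symmetric, walk-based form of criticality. -/
def CritP (G : SimpleGraph V) (s t : V) (C : Set V) : Prop :=
  ∃ (a v b : V) (p : G.Walk a v) (q : G.Walk v b), G.Adj a s ∧ G.Adj b t ∧
    (∀ x ∈ p.support, x ∈ C ∧ ¬ G.Adj x t) ∧ (∀ x ∈ q.support, x ∈ C ∧ ¬ G.Adj x s) ∧
    ∀ x ∈ p.support, x ∈ q.support → x = v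

theorem CritP.symm {G : SimpleGraph V} {s t : V} {C : Set V} (h : CritP G s t C) :
    CritP G t s C := by
  obtain ⟨a, v, b, p, q, ha, hb, hp, hq, hd⟩ := h
  refine ⟨b, v, a, q.reverse, p.reverse, hb, ha, by simpa using hq, by simpa using hp, ?_⟩
  intro x hx hx'
  exact hd x (by simpa using hx') (by simpa using hx)

theorem CritP.critical [DecidableEq V] {G : SimpleGraph V} {s t : V} {C : Set V} (hst : s ≠ t)
    (hs : s ∉ C) (ht : t ∉ C) (h : CritP G s t C) : Critical G s t C := by
  obtain ⟨a, v, b, p0, q0, ha, hb, hp0, hq0, hd0⟩ := h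
  obtain ⟨p, hpp, hps⟩ : ∃ p : G.Walk a v, p.IsPath ∧ p.support ⊆ p0.support :=
    ⟨_, p0.bypass_isPath, p0.support_bypass_subset_support⟩
  obtain ⟨q, hqq, hqs⟩ : ∃ q : G.Walk v b, q.IsPath ∧ q.support ⊆ q0.support :=
    ⟨_, q0.bypass_isPath, q0.support_bypass_subset_support⟩
  have hp : ∀ x ∈ p.support, x ∈ C ∧ ¬ G.Adj x t := fun x hx => hp0 x (hps hx)
  have hq : ∀ x ∈ q.support, x ∈ C ∧ ¬ G.Adj x s := fun x hx => hq0 x (hqs hx)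
  have hd : ∀ x ∈ p.support, x ∈ q.support → x = v := fun x h1 h2 => hd0 x (hps h1) (hqs h2)
  let P : G.Walk s v := .cons ha.symm p
  let Q : G.Walk v t := q.concat hb
  have hPp : P.IsPath := hpp.cons (fun h => hs (hp _ h).1)
  have hQp : Q.IsPath := hqq.concat (fun h => ht (hq _ h).1) hb
  have hPs : ∀ x ∈ P.support, x = s ∨ x ∈ p.support := by
    intro x hx
    simpa [P] using hx
  have hQs : ∀ x ∈ Q.support, x ∈ q.support ∨ x = t := by
    intro x hx
    simpa [Q, Walk.support_concat] using hx
  have hPQ : ∀ x ∈ P.support, x ∈ Q.support → x = v := by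
    intro x hx hx'
    rcases hPs x hx with rfl | hx <;> rcases hQs x hx' with hx' | rfl
    · exact absurd (hq _ hx').1 hs
    · exact absurd rfl hst
    · exact hd x hx hx'
    · exact absurd (hp _ hx).1 ht
  have hw : (P.append Q).IsPath := by
    rw [Walk.isPath_def, Walk.support_append, List.nodup_append]
    refine ⟨hPp.support_nodup, hQp.support_nodup.tail, ?_⟩
    rintro x hx y hy rfl
    have h1 := hPQ x hx (List.mem_of_mem_tail hy)
    subst h1
    have h2 := hQp.support_nodup
    rw [← Walk.cons_tail_support] at h2
    exact (List.nodup_cons.mp h2).1 hy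
  have hv : v ∈ (P.append Q).support := by
    rw [Walk.mem_support_append_iff]
    exact Or.inl P.end_mem_support
  have hts := take_drop_disj _ hw hv
  have hT : ∀ x ∈ ((P.append Q).takeUntil v hv).support, x ∈ P.support := by
    intro x hx
    have hx2 := (P.append Q).support_takeUntil_subset_support hv hx
    rw [Walk.takeUntil_append_of_mem_left P Q P.end_mem_support] at hx
    exact P.support_takeUntil_subset_support _ hx
  have hD : ∀ x ∈ ((P.append Q).dropUntil v hv).support, x ∈ Q.support := by
    intro x hx
    have hx2 := (P.append Q).support_dropUntil_subset_support hv hx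
    rw [Walk.mem_support_append_iff] at hx2
    rcases hx2 with hx2 | hx2
    · have : x ∈ ((P.append Q).takeUntil v hv).support := by
        rw [Walk.takeUntil_append_of_mem_left P Q P.end_mem_support]
        have hnil := hPp.dropUntil P.end_mem_support
        rw [Walk.isPath_iff_eq_nil] at hnil
        have h3 := P.take_spec P.end_mem_support
        rw [hnil, Walk.append_nil] at h3
        rwa [h3]
      rw [hts x this hx]
      exact Q.start_mem_support
    · exact hx2
  refine ⟨v, (hp v p.end_mem_support).1, (hq v q.start_mem_support).2,
    (hp v p.end_mem_support).2, P.append Q, hw, hv, ?_, ?_, ?_⟩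
  · intro x hx
    rw [Walk.mem_support_append_iff] at hx
    rcases hx with hx | hx
    · rcases hPs x hx with hx | hx
      · exact Or.inl hx
      · exact Or.inr (Or.inr (hp x hx).1)
    · rcases hQs x hx with hx | hx
      · exact Or.inr (Or.inr (hq x hx).1)
      · exact Or.inr (Or.inl hx)
  · intro x hx hxs _
    rcases hPs x (hT x hx) with h | h
    · exact absurd h hxs
    · exact (hp x h).2
  · intro x hx _ hxt
    rcases hQs x (hD x hx) with h | h
    · exact (hq x h).2
    · exact absurd h hxt

theorem half {G : SimpleGraph V} {s t : V} {C : Set V} {c a : V} (hconn : (G.induce C).Connected)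
    (hc : Cuts G s t C c) (ha : a ∈ C) (has : G.Adj a s) :
    ∃ p : G.Walk a c, ∀ x ∈ p.support, x ∈ C ∧ (x ≠ c → ¬ G.Adj x t ∧
      ∃ w : G.Walk a x, ∀ y ∈ w.support, y ∈ C ∧ y ≠ c) := by
  classical
  obtain ⟨p, hp, hpC⟩ := conn_walk hconn.preconnected ha hc.1
  refine ⟨p, fun x hx => ⟨hpC x hx, fun hxc => ?_⟩⟩
  have hw : ∀ y ∈ (p.takeUntil x hx).support, y ∈ C ∧ y ≠ c := by
    intro y hy
    refine ⟨hpC y (p.support_takeUntil_subset_support hx hy), ?_⟩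
    rintro rfl
    exact Walk.endpoint_notMem_support_takeUntil hp hx hxc.symm hy
  refine ⟨fun hxt => ?_, _, hw⟩
  exact (hw c (hc.2 a x _ has hxt fun y hy => (hw y hy).1)).2 rfl

theorem twoHalves [Fintype V] {G : SimpleGraph V} (hBi : Biconnected G) {s t : V} (hst : s ≠ t)
    {C : Set V} (hC : IsCompAt G s t C) {c : V} (hc : Cuts G s t C c) :
    ∃ (a b : V) (p : G.Walk a c) (q : G.Walk c b), G.Adj a s ∧ G.Adj b t ∧
      (∀ x ∈ p.support, x ∈ C ∧ (x ≠ c → ¬ G.Adj x t)) ∧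
      (∀ x ∈ q.support, x ∈ C ∧ (x ≠ c → ¬ G.Adj x s)) ∧
      ∀ x ∈ p.support, x ∈ q.support → x = c := by
  obtain ⟨a, ha, has⟩ := attach hBi hst hC
  obtain ⟨b, hb, hbt⟩ := attach hBi hst.symm hC.symm
  obtain ⟨p, hp⟩ := half hC.2.2.1 hc ha has
  obtain ⟨q, hq⟩ := half hC.2.2.1 hc.symm hb hbt
  refine ⟨a, b, p, q.reverse, has, hbt, fun x hx => ⟨(hp x hx).1, fun h => ((hp x hx).2 h).1⟩,
    fun x hx => ?_, fun x hx hx' => ?_⟩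
  · have hx : x ∈ q.support := by simpa using hx
    exact ⟨(hq x hx).1, fun h => ((hq x hx).2 h).1⟩
  · have hx' : x ∈ q.support := by simpa using hx'
    by_contra hne
    obtain ⟨w1, hw1⟩ := ((hp x hx).2 hne).2
    obtain ⟨w2, hw2⟩ := ((hq x hx').2 hne).2
    have hall : ∀ y ∈ (w1.append w2.reverse).support, y ∈ C ∧ y ≠ c := by
      intro y hy
      rw [Walk.mem_support_append_iff] at hy
      rcases hy with hy | hy
      · exact hw1 y hy
      · exact hw2 y (by simpa using hy)
    exact (hall c (hc.2 a b _ has hbt fun y hy => (hall y hy).1)).2 rfl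

theorem compT {G : SimpleGraph V} {s t : V} (hst : s ≠ t) {C : Set V} (hC : IsCompAt G s t C)
    {c : V} (hc : c ∈ C) {K : Set V} (hK : IsCCOf G (C \ {c}) K) (hno : ∀ u ∈ K, ¬ G.Adj u t) :
    IsCompAt G c s K ∧ SepPair G c s := by
  have hKC : ∀ u ∈ K, u ∈ C := fun u hu => (hK.2.1 hu).1
  have h1 : IsCompAt G c s K := by
    refine ⟨hK.1, fun u hu => ⟨(hK.2.1 hu).2, (hC.2.1 (hKC u hu)).1⟩, hK.2.2.1, ?_⟩
    intro u hu w hw huw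
    have hwt : w ≠ t := by
      rintro rfl
      exact hno u hu huw
    exact hK.2.2.2 u hu w ⟨hC.2.2.2 u (hKC u hu) w ⟨hw.2, hwt⟩ huw, hw.1⟩ huw
  have htC : t ∉ C := fun h => (hC.2.1 h).2 rfl
  refine ⟨h1, sepPair_of (z := t) (hC.2.1 hc).1 h1 (fun h => htC (hKC t h)) ?_ hst.symm⟩
  rintro rfl
  exact htC hc

theorem not_both {G : SimpleGraph V} {s t : V} {C : Set V} {c : V} (hc : Cuts G s t C c)
    {K : Set V} (hK : IsCCOf G (C \ {c}) K) {u v : V} (hu : u ∈ K) (hus : G.Adj u s)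
    (hv : v ∈ K) (hvt : G.Adj v t) : False := by
  obtain ⟨w, -, hw⟩ := conn_walk hK.2.2.1.preconnected hu hv
  exact (hK.2.1 (hw c (hc.2 u v w hus hvt fun x hx => (hK.2.1 (hw x hx)).1))).2 rfl

/-- If the cut vertex `c` is adjacent to `s` then it is the only neighbour of `s` in `C`. -/
theorem only_nbr {G : SimpleGraph V} (hTr : NoTransitiveEdges G) {s t : V} (hst : s ≠ t)
    {C : Set V} (hC : IsCompAt G s t C) {c : V} (hc : Cuts G s t C c) (hcs : G.Adj c s) :
    ∀ u ∈ C, G.Adj u s → u = c := by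
  intro u hu hus
  by_contra hne
  obtain ⟨K, hK, huK⟩ := cc_exists G (D := C \ {c}) ⟨hu, hne⟩
  exact hTr c s (compT hst hC hc.1 hK fun v hv hvt => not_both hc hK huK hus hv hvt).2 hcs

theorem caseC [Fintype V] {G : SimpleGraph V} (hBi : Biconnected G)
    (hSP : ¬ ContainsK4Subdivision G) (hTr : NoTransitiveEdges G) {s t : V} (hst : s ≠ t)
    {C : Set V} (hC : IsCompAt G s t C) {c : V} (hc : Cuts G s t C c) (hcs : G.Adj c s)
    (hct : ¬ G.Adj c t) {v : V} (hv : v ∈ C) (hvs : ¬ G.Adj v s) (hvt : ¬ G.Adj v t) :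
    CritP G s t C := by
  have hN := only_nbr hTr hst hC hc hcs
  have hvc : v ≠ c := by
    rintro rfl
    exact hvs hcs
  obtain ⟨K, hK, hvK⟩ := cc_exists G (D := C \ {c}) ⟨hv, hvc⟩
  have hKs : ∀ u ∈ K, ¬ G.Adj u s := fun u hu h => (hK.2.1 hu).2 (hN u (hK.2.1 hu).1 h)
  have hKC : ∀ u ∈ K, u ∈ C := fun u hu => (hK.2.1 hu).1
  have hcK : c ∉ K := fun h => (hK.2.1 h).2 rfl
  obtain ⟨hKcomp', hKsep'⟩ := compT hst.symm hC.symm hc.1 hK hKs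
  have hct' : c ≠ t := hKsep'.1
  obtain ⟨d, hd⟩ := cut_exists hBi hSP hKsep' hKcomp'
  by_cases hdt : G.Adj d t
  · have hNt := only_nbr hTr hct'.symm hKcomp'.symm hd.symm hdt
    have hvd : v ≠ d := by
      rintro rfl
      exact hvt hdt
    obtain ⟨L, hL, hvL⟩ := cc_exists G (D := K \ {d}) ⟨hvK, hvd⟩
    have hLt : ∀ u ∈ L, ¬ G.Adj u t := fun u hu h => (hL.2.1 hu).2 (hNt u (hL.2.1 hu).1 h)
    obtain ⟨hLcomp, hLsep⟩ := compT hct' hKcomp' hd.1 hL hLt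
    obtain ⟨e, he, hed⟩ := attach hBi hLsep.1 hLcomp
    obtain ⟨a, ha, hac⟩ := attach hBi hLsep.1.symm hLcomp.symm
    obtain ⟨w, -, hw⟩ := conn_walk hL.2.2.1.preconnected ha he
    have hqK : ∀ x ∈ (w.concat hed).support, x ∈ K := by
      intro x hx
      rw [Walk.support_concat] at hx
      simp at hx
      rcases hx with hx | rfl
      · exact (hL.2.1 (hw x hx)).1
      · exact hd.1
    refine ⟨c, a, d, .cons hac.symm .nil, w.concat hed, hcs, hdt, ?_, ?_, ?_⟩
    · intro x hx
      simp at hx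
      rcases hx with rfl | rfl
      · exact ⟨hc.1, hct⟩
      · exact ⟨hKC _ (hL.2.1 ha).1, hLt _ ha⟩
    · exact fun x hx => ⟨hKC x (hqK x hx), hKs x (hqK x hx)⟩
    · intro x hx hx'
      simp at hx
      rcases hx with rfl | rfl
      · exact absurd (hqK _ hx') hcK
      · rfl
  · obtain ⟨a, b, p, q, ha, hb, hp, hq, hpq⟩ := twoHalves hBi hct' hKcomp' hd
    refine ⟨c, d, b, .cons ha.symm p, q, hcs, hb, ?_, ?_, ?_⟩
    · intro x hx
      rw [Walk.support_cons, List.mem_cons] at hx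
      rcases hx with rfl | hx
      · exact ⟨hc.1, hct⟩
      · refine ⟨hKC x (hp x hx).1, ?_⟩
        by_cases hxd : x = d
        · exact hxd ▸ hdt
        · exact (hp x hx).2 hxd
    · exact fun x hx => ⟨hKC x (hq x hx).1, hKs x (hq x hx).1⟩
    · intro x hx hx'
      rw [Walk.support_cons, List.mem_cons] at hx
      rcases hx with rfl | hx
      · exact absurd (hq _ hx').1 hcK
      · exact hpq x hx hx'

theorem critP_of_heavy [Fintype V] {G : SimpleGraph V} (hBi : Biconnected G)
    (hSP : ¬ ContainsK4Subdivision G) (hTr : NoTransitiveEdges G) {s t : V} (hst : SepPair G s t)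
    {C : Set V} (hC : IsCompAt G s t C) (hH : Heavy G s t C) : CritP G s t C := by
  obtain ⟨v, hv, hvs, hvt⟩ := hH
  obtain ⟨c, hc⟩ := cut_exists hBi hSP hst hC
  by_cases hcs : G.Adj c s
  · by_cases hct : G.Adj c t
    · exfalso
      have hvc : v ≠ c := by
        rintro rfl
        exact hvs hcs
      have hN := only_nbr hTr hst.1 hC hc hcs
      have hNt := only_nbr hTr hst.1.symm hC.symm hc.symm hct
      obtain ⟨K, hK, hvK⟩ := cc_exists G (D := C \ {c}) ⟨hv, hvc⟩
      exact hTr c s (compT hst.1 hC hc.1 hK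
        fun u hu h => (hK.2.1 hu).2 (hNt u (hK.2.1 hu).1 h)).2 hcs
    · exact caseC hBi hSP hTr hst.1 hC hc hcs hct hv hvs hvt
  · by_cases hct : G.Adj c t
    · exact (caseC hBi hSP hTr hst.1.symm hC.symm hc.symm hct hcs hv hvt hvs).symm
    · obtain ⟨a, b, p, q, ha, hb, hp, hq, hpq⟩ := twoHalves hBi hst.1 hC hc
      refine ⟨a, c, b, p, q, ha, hb, fun x hx => ⟨(hp x hx).1, ?_⟩,
        fun x hx => ⟨(hq x hx).1, ?_⟩, hpq⟩
      · by_cases hxd : x = c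
        · exact hxd ▸ hct
        · exact (hp x hx).2 hxd
      · by_cases hxd : x = c
        · exact hxd ▸ hcs
        · exact (hq x hx).2 hxd

/-- In a biconnected series-parallel simple graph without transitive edges, a component
with respect to a separation pair is critical if and only if it is heavy. -/
theorem stmt0 [Fintype V] [DecidableEq V] (G : SimpleGraph V)
    (hBi : Biconnected G) (hSP : ¬ ContainsK4Subdivision G)
    (hTr : NoTransitiveEdges G)
    (s t : V) (hst : SepPair G s t)
    (C : Set V) (hC : IsCompAt G s t C) :
    Critical G s t C ↔ Heavy G s t C := by
  constructor
  · rintro ⟨v, hv, hvs, hvt, -⟩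
    exact ⟨v, hv, hvs, hvt⟩
  · intro h
    exact (critP_of_heavy hBi hSP hTr hst hC h).critical hst.1 (fun h => (hC.2.1 h).1 rfl)
      (fun h => (hC.2.1 h).2 rfl)
end

section
/- Let G be a biconnected simple graph, let (s,t) be a separation pair of G, let G' be a component of G with respect to (s,t), and let v be an internal vertex of G'. Then there is a path from s to t all of whose vertices belong to G' and which passes through v. -/
open SimpleGraph

variable {V : Type*}

theorem aux_append {G : SimpleGraph V} {a b c : V} (p : G.Walk a b) (q : G.Walk b c)
    (hp : p.IsPath) (hq : q.IsPath) (h : ∀ y ∈ p.support, y ∈ q.support → y = b) :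
    (p.append q).IsPath := by
  rw [Walk.isPath_def, Walk.support_append, List.nodup_append']
  refine ⟨hp.support_nodup, hq.support_nodup.tail, ?_⟩
  intro y hy hy2
  have hyb := h y hy (List.mem_of_mem_tail hy2)
  subst hyb
  have := hq.support_nodup
  rw [← Walk.cons_tail_support] at this
  exact (List.nodup_cons.mp this).1 hy2

theorem aux_common {G : SimpleGraph V} {a b c : V} {p : G.Walk a b} {q : G.Walk b c}
    (h : (p.append q).IsPath) : ∀ y ∈ p.support, y ∈ q.support → y = b := by
  intro y hy hy2
  by_contra hne
  exact h.ne_of_mem_support_of_append hne hy hy2 rfl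

/-- Reroute a path through a new vertex `v`. -/
theorem aux_reroute {G : SimpleGraph V} {a b u v x : V} (P1 : G.Walk a u) (P2 : G.Walk u b)
    (hP : (P1.append P2).IsPath) (huv : G.Adj u v) (q : G.Walk v x) (hq : q.IsPath)
    (hu : u ∉ q.support) (hx : x ∈ P2.support)
    (hd : ∀ y ∈ q.support, y ∈ P1.support ∨ y ∈ P2.support → y = x) :
    ∃ w : G.Walk a b, w.IsPath ∧ v ∈ w.support ∧
      ∀ y ∈ w.support, y ∈ P1.support ∨ y ∈ P2.support ∨ y ∈ q.support := by
  obtain ⟨L, R, hLR⟩ := Walk.mem_support_iff_exists_append.mp hx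
  have h2 : (L.append R).IsPath := hLR ▸ hP.of_append_right
  have hc := aux_common hP
  have hc2 := aux_common h2
  have hRP : ∀ y ∈ R.support, y ∈ P2.support := by
    intro y hy; rw [hLR, Walk.mem_support_append_iff]; exact Or.inr hy
  have hux : u ≠ x := fun h => hu (h ▸ q.end_mem_support)
  have huR : u ∉ R.support := fun h => hux (hc2 u L.start_mem_support h)
  have h3 : (q.append R).IsPath := aux_append q R hq h2.of_append_right
    (fun y hy hy2 => hd y hy (Or.inr (hRP y hy2)))
  have hu3 : u ∉ (q.append R).support := by
    rw [Walk.mem_support_append_iff]; tauto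
  refine ⟨P1.append (Walk.cons huv (q.append R)),
    aux_append _ _ hP.of_append_left (h3.cons hu3) ?_, ?_, ?_⟩
  · intro y hy hy2
    rw [Walk.support_cons, List.mem_cons, Walk.mem_support_append_iff] at hy2
    rcases hy2 with h | h | h
    · exact h
    · have hyx := hd y h (Or.inl hy)
      exact hc y hy (hyx ▸ hx)
    · exact hc y hy (hRP y h)
  · simp [Walk.mem_support_append_iff]
  · intro y hy
    simp only [Walk.support_cons, List.mem_cons, Walk.mem_support_append_iff] at hy
    rcases hy with h | h | h | h
    · exact Or.inl h
    · exact Or.inl (h ▸ P1.end_mem_support)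
    · exact Or.inr (Or.inr h)
    · exact Or.inr (Or.inl (hRP y h))

/-- First hit of the set `P` by a walk starting in `C`. -/
theorem aux_first {G : SimpleGraph V} {s t : V} {C P Z : Set V}
    (hcl : ∀ u ∈ C, ∀ w ∈ {v | v ≠ s ∧ v ≠ t}, G.Adj u w → w ∈ C)
    (hPZ : ∀ y ∈ Z, y = s ∨ y = t → y ∈ P)
    {a b : V} (w : G.Walk a b) (hZ : ∀ y ∈ w.support, y ∈ Z)
    (hb : b ∈ P) (ha : a ∈ C ∨ a ∈ P) :
    ∃ x ∈ P, ∃ q : G.Walk a x, (∀ y ∈ q.support, y ∈ Z) ∧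
      ∀ y ∈ q.support, y = x ∨ (y ∈ C ∧ y ∉ P) := by
  induction w with
  | nil => exact ⟨_, hb, Walk.nil, hZ, by simp⟩
  | @cons a u b h w ih =>
    by_cases haP : a ∈ P
    · exact ⟨a, haP, Walk.nil, by simpa using hZ a (by simp), by simp⟩
    · have haC : a ∈ C := ha.resolve_right haP
      have huZ : u ∈ Z := hZ u (by simp)
      have hu : u ∈ C ∨ u ∈ P := by
        by_cases huP : u ∈ P
        · exact Or.inr huP
        · exact Or.inl (hcl a haC u ⟨fun hh => huP (hPZ u huZ (Or.inl hh)),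
            fun hh => huP (hPZ u huZ (Or.inr hh))⟩ h)
      obtain ⟨x, hx, q, hq1, hq2⟩ := ih (fun y hy => hZ y (by simp [hy])) hb hu
      refine ⟨x, hx, Walk.cons h q, ?_, ?_⟩
      · intro y hy
        rw [Walk.support_cons, List.mem_cons] at hy
        rcases hy with rfl | hy
        · exact hZ _ (by simp)
        · exact hq1 y hy
      · intro y hy
        rw [Walk.support_cons, List.mem_cons] at hy
        rcases hy with rfl | hy
        · exact Or.inr ⟨haC, haP⟩
        · exact hq2 y hy

theorem aux_avoid [Fintype V] {G : SimpleGraph V} (hBi : Biconnected G) (x a b : V)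
    (ha : a ≠ x) (hb : b ≠ x) : ∃ w : G.Walk a b, ∀ y ∈ w.support, y ≠ x := by
  obtain ⟨w⟩ := (hBi.2.2 x).preconnected ⟨a, ha⟩ ⟨b, hb⟩
  refine ⟨w.map (Embedding.induce _).toHom, ?_⟩
  intro y hy
  have hy' := (congrArg (y ∈ ·) (Walk.support_map (Embedding.induce _).toHom w)).mp hy
  obtain ⟨z, -, rfl⟩ := List.mem_map.mp hy'
  exact z.2

/-- A vertex of `C` reaches the pole `s` inside `C ∪ {s}`. -/
theorem aux_pole [Fintype V] {G : SimpleGraph V} (hBi : Biconnected G) {s t : V} (hst : s ≠ t)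
    {C : Set V} (hCt : t ∉ C)
    (hcl : ∀ u ∈ C, ∀ w ∈ {v | v ≠ s ∧ v ≠ t}, G.Adj u w → w ∈ C)
    {v : V} (hv : v ∈ C) : ∃ w : G.Walk v s, ∀ y ∈ w.support, y = s ∨ y ∈ C := by
  have hvt : v ≠ t := fun h => hCt (h ▸ hv)
  obtain ⟨w, hw⟩ := aux_avoid hBi t v s hvt hst
  obtain ⟨x, hx, q, -, hq⟩ := aux_first (P := {s}) (Z := {y | y ≠ t}) hcl
    (fun y hy h => h.resolve_right hy) w hw rfl (Or.inl hv)
  obtain rfl : x = s := hx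
  exact ⟨q, fun y hy => (hq y hy).imp_right And.left⟩

theorem aux_step [Fintype V] {G : SimpleGraph V} (hBi : Biconnected G) {s t : V} (hst : s ≠ t)
    {C : Set V}
    (hcl : ∀ u ∈ C, ∀ w ∈ {v | v ≠ s ∧ v ≠ t}, G.Adj u w → w ∈ C)
    {u v : V} (hv : v ∈ C) (huv : G.Adj u v)
    (hu : ∃ w : G.Walk s t, w.IsPath ∧
      (∀ x ∈ w.support, x = s ∨ x = t ∨ x ∈ C) ∧ u ∈ w.support) :
    ∃ w : G.Walk s t, w.IsPath ∧
      (∀ x ∈ w.support, x = s ∨ x = t ∨ x ∈ C) ∧ v ∈ w.support := by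
  classical
  obtain ⟨p, hp, hpC, hup⟩ := hu
  by_cases hvp : v ∈ p.support
  · exact ⟨p, hp, hpC, hvp⟩
  obtain ⟨z, hzu, hzp⟩ : ∃ z, z ≠ u ∧ z ∈ p.support := by
    by_cases h : s = u
    · exact ⟨t, fun h2 => hst (h.trans h2.symm), p.end_mem_support⟩
    · exact ⟨s, h, p.start_mem_support⟩
  obtain ⟨w, hw⟩ := aux_avoid hBi u v z huv.ne' hzu
  obtain ⟨x, hx, q', hq1, hq2⟩ := aux_first (P := {y | y ∈ p.support}) (Z := {y | y ≠ u}) hcl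
    (by
      rintro y - (rfl | rfl)
      · exact p.start_mem_support
      · exact p.end_mem_support) w hw hzp (Or.inl hv)
  obtain ⟨q, hq, hqs⟩ : ∃ q : G.Walk v x, q.IsPath ∧ ∀ y ∈ q.support, y ∈ q'.support :=
    ⟨q'.bypass, q'.bypass_isPath, fun y hy => q'.support_bypass_subset_support hy⟩
  have huq : u ∉ q.support := fun h => hq1 u (hqs u h) rfl
  have hqd : ∀ y ∈ q.support, y ∈ p.support → y = x := fun y hy hyp =>
    (hq2 y (hqs y hy)).resolve_right (fun h => h.2 hyp)
  have hqC : ∀ y ∈ q.support, y ∈ p.support ∨ y ∈ C := by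
    intro y hy
    rcases hq2 y (hqs y hy) with h | h
    · exact Or.inl (h ▸ hx)
    · exact Or.inr h.1
  obtain ⟨P1, P2, hP⟩ := Walk.mem_support_iff_exists_append.mp hup
  have hmem : ∀ y, y ∈ p.support ↔ y ∈ P1.support ∨ y ∈ P2.support := by
    intro y; rw [hP, Walk.mem_support_append_iff]
  have key : ∀ y, y ∈ P1.support ∨ y ∈ P2.support ∨ y ∈ q.support →
      y = s ∨ y = t ∨ y ∈ C := by
    rintro y (h | h | h)
    · exact hpC y ((hmem y).2 (Or.inl h))
    · exact hpC y ((hmem y).2 (Or.inr h))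
    · rcases hqC y h with h | h
      · exact hpC y h
      · exact Or.inr (Or.inr h)
  rw [hP] at hp
  rcases (hmem x).1 hx with hx1 | hx2
  · obtain ⟨r, hr, hvr, hrs⟩ := aux_reroute P2.reverse P1.reverse
      (by rw [← Walk.reverse_append]; exact hp.reverse) huv q hq huq (by simpa using hx1)
      (fun y hy h => hqd y hy ((hmem y).2 (by simpa [or_comm] using h)))
    refine ⟨r.reverse, hr.reverse, ?_, by simpa using hvr⟩
    intro y hy
    apply key
    have := hrs y (by simpa using hy)
    simp only [Walk.support_reverse, List.mem_reverse] at this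
    tauto
  · obtain ⟨r, hr, hvr, hrs⟩ := aux_reroute P1 P2 hp huv q hq huq hx2
      (fun y hy h => hqd y hy ((hmem y).2 h))
    exact ⟨r, hr, fun y hy => key y (hrs y hy), hvr⟩

/-- In a biconnected simple graph, for every separation pair `(s, t)`, every component
`C` with respect to `(s, t)`, and every internal vertex `v` of the component, there is a
path from `s` to `t` all of whose vertices belong to the component and which passes
through `v`. -/
theorem stmt1 [Fintype V] (G : SimpleGraph V) (hBi : Biconnected G)
    (s t : V) (hst : SepPair G s t)
    (C : Set V) (hC : IsCompAt G s t C)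
    (v : V) (hv : v ∈ C) :
    ∃ (w : G.Walk s t), w.IsPath ∧
      (∀ x ∈ w.support, x = s ∨ x = t ∨ x ∈ C) ∧ v ∈ w.support := by
  classical
  have hne : s ≠ t := hst.1
  obtain ⟨-, hCD, -, hcl⟩ := hC
  have hCs : s ∉ C := fun h => (hCD h).1 rfl
  have hCt : t ∉ C := fun h => (hCD h).2 rfl
  obtain ⟨ws, hws⟩ := aux_pole hBi hne hCt hcl hv
  obtain ⟨wt, hwt⟩ := aux_pole hBi hne.symm hCs
    (fun u hu w hw h => hcl u hu w ⟨hw.2, hw.1⟩ h) hv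
  have base : ∃ w : G.Walk s t, w.IsPath ∧
      (∀ x ∈ w.support, x = s ∨ x = t ∨ x ∈ C) ∧ s ∈ w.support := by
    refine ⟨(ws.reverse.append wt).bypass, Walk.bypass_isPath _, ?_, Walk.start_mem_support _⟩
    intro x hx
    have hx' := Walk.support_bypass_subset_support _ hx
    rw [Walk.mem_support_append_iff, Walk.support_reverse, List.mem_reverse] at hx'
    rcases hx' with h | h
    · have := hws x h
      tauto
    · have := hwt x h
      tauto
  have main : ∀ {a b : V} (w : G.Walk a b), b = s → (∀ y ∈ w.support, y = s ∨ y ∈ C) →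
      ∃ w : G.Walk s t, w.IsPath ∧
        (∀ x ∈ w.support, x = s ∨ x = t ∨ x ∈ C) ∧ a ∈ w.support := by
    intro a b w
    induction w with
    | nil => rintro rfl -; exact base
    | @cons a u b h w ih =>
      intro hb hw
      rcases hw a (by simp) with rfl | haC
      · exact base
      · exact aux_step hBi hne hcl haC h.symm (ih hb (fun y hy => hw y (by simp [hy])))
  exact main ws rfl hws
end

section
/- Let G be a biconnected series-parallel simple graph with no transitive edges, let (s,t) be a separation pair of G, let G₁ be a component of G with respect to (s,t), and let p be a path from s to t all of whose vertices belong to G₁ of maximum length (number of edges) among all such paths. Then p is an induced path of G, i.e., two vertices of p are adjacent in G if and only if they are consecutive on p. -/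
open SimpleGraph

variable {V : Type*}

lemma aux_minimal {G : SimpleGraph V} (S A B : Set V) (hAB : Disjoint A B) :
    ∀ (n : ℕ) (u v : V) (w : G.Walk u v), w.length = n → u ∈ A → v ∈ B →
      (∀ z ∈ w.support, z ∈ S) →
      ∃ (a b : V) (q : G.Walk a b), a ∈ A ∧ b ∈ B ∧ q.IsPath ∧ (∀ z ∈ q.support, z ∈ S) ∧
        (∀ z ∈ interiorSet q, z ∉ A ∧ z ∉ B) := by
  classical
  intro n
  induction n using Nat.strong_induction_on with
  | _ n ih =>
    intro u v w hn hu hv hS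
    by_cases h1 : ∃ z ∈ interiorSet w.bypass, z ∈ A
    · obtain ⟨z, ⟨hz, hzu, hzv⟩, hzA⟩ := h1
      have hz' := w.support_bypass_subset_support hz
      have hlen : (w.dropUntil z hz').length < n := by
        have h3 := congrArg Walk.length (w.take_spec hz')
        rw [Walk.length_append] at h3
        have : (w.takeUntil z hz').length ≠ 0 := fun h =>
          hzu (Walk.eq_of_length_eq_zero h).symm
        omega
      exact ih _ hlen z v _ rfl hzA hv
        (fun y hy => hS y (w.support_dropUntil_subset_support hz' hy))
    by_cases h2 : ∃ z ∈ interiorSet w.bypass, z ∈ B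
    · obtain ⟨z, ⟨hz, hzu, hzv⟩, hzB⟩ := h2
      have hz' := w.support_bypass_subset_support hz
      have hlen : (w.takeUntil z hz').length < n := by
        have h3 := congrArg Walk.length (w.take_spec hz')
        rw [Walk.length_append] at h3
        have : (w.dropUntil z hz').length ≠ 0 := fun h =>
          hzv (Walk.eq_of_length_eq_zero h)
        omega
      exact ih _ hlen u z _ rfl hu hzB
        (fun y hy => hS y (w.support_takeUntil_subset_support hz' hy))
    push Not at h1 h2
    exact ⟨u, v, w.bypass, hu, hv, w.bypass_isPath,
      fun z hz => hS z (w.support_bypass_subset_support hz), fun z hz => ⟨h1 z hz, h2 z hz⟩⟩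

lemma aux_interior {G : SimpleGraph V} {x y : V} (P : G.Walk x y) (hne : x ≠ y)
    (he : s(x, y) ∉ P.edges) : ∃ z, z ∈ interiorSet P := by
  cases P with
  | nil => exact absurd rfl hne
  | @cons _ v _ h q =>
    refine ⟨v, ?_, h.ne', ?_⟩
    · simp
    · rintro rfl
      simp at he

lemma aux_split {G : SimpleGraph V} [DecidableEq V] {x y : V} (P : G.Walk x y) (hP : P.IsPath)
    (a : V) (ha : a ∈ P.support) (z : V) (h1 : z ∈ (P.takeUntil a ha).support)
    (h2 : z ∈ (P.dropUntil a ha).support) : z = a := by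
  rw [← P.take_spec ha] at hP
  by_contra hza
  have h2' : z ∈ (P.dropUntil a ha).support.tail := by
    rw [Walk.mem_support_iff] at h2
    exact h2.resolve_left hza
  have hnd := hP.support_nodup
  rw [Walk.support_append] at hnd
  exact (List.nodup_append.mp hnd).2.2 _ h1 _ h2' rfl

lemma aux_cycle [Fintype V] (G : SimpleGraph V) (hSP : ¬ ContainsK4Subdivision G)
    (hTr : NoTransitiveEdges G) {x y : V} (hxy : G.Adj x y)
    (P Q : G.Walk x y) (hP : P.IsPath) (hQ : Q.IsPath)
    (heP : s(x, y) ∉ P.edges) (heQ : s(x, y) ∉ Q.edges)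
    (hd : Disjoint (interiorSet P) (interiorSet Q)) : False := by
  classical
  have hpre : (G.induce {v | v ≠ x ∧ v ≠ y}).Preconnected := by
    by_contra h
    exact hTr x y ⟨hxy.ne, h⟩ hxy
  obtain ⟨u, hu⟩ := aux_interior P hxy.ne heP
  obtain ⟨v, hv⟩ := aux_interior Q hxy.ne heQ
  obtain ⟨w⟩ := hpre ⟨u, hu.2⟩ ⟨v, hv.2⟩
  have hw : ∀ z ∈ (w.map (Embedding.induce _).toHom).support, z ∈ {v | v ≠ x ∧ v ≠ y} := by
    intro z hz
    rw [Walk.support_map] at hz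
    obtain ⟨z', -, rfl⟩ := List.mem_map.mp hz
    exact z'.2
  obtain ⟨a, b, q, ha, hb, hq, hqS, hqi⟩ :=
    aux_minimal {v | v ≠ x ∧ v ≠ y} _ _ hd _ _ _ (w.map (Embedding.induce _).toHom) rfl hu hv hw
  obtain ⟨haP, hax, hay⟩ := id ha
  obtain ⟨hbQ, hbx, hby⟩ := id hb
  have hdis : ∀ z, z ∈ interiorSet P → z ∈ interiorSet Q → False :=
    fun z h1 h2 => Set.disjoint_left.mp hd h1 h2
  have hab : a ≠ b := by
    rintro rfl
    exact hdis _ ha hb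
  have hsub : ∀ {x y : V} (P : G.Walk x y) (hP : P.IsPath) (a : V) (haP : a ∈ P.support)
      (hax : a ≠ x) (hay : a ≠ y),
      (∀ z ∈ interiorSet (P.takeUntil a haP), z ∈ interiorSet P ∧ z ≠ a) ∧
      (∀ z ∈ interiorSet (P.dropUntil a haP).reverse, z ∈ interiorSet P ∧ z ≠ a) ∧
      (∀ z, z ∈ interiorSet (P.takeUntil a haP) →
        z ∈ interiorSet (P.dropUntil a haP).reverse → False) := by
    intro x y P hP a haP hax hay
    refine ⟨?_, ?_, ?_⟩
    · rintro z ⟨h1, h2, h3⟩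
      refine ⟨⟨P.support_takeUntil_subset_support haP h1, h2, ?_⟩, h3⟩
      rintro rfl
      exact h3 (aux_split P hP a haP _ h1 (Walk.end_mem_support _))
    · rintro z ⟨h1, h2, h3⟩
      rw [Walk.support_reverse, List.mem_reverse] at h1
      refine ⟨⟨P.support_dropUntil_subset_support haP h1, ?_, h2⟩, h3⟩
      rintro rfl
      exact h3 (aux_split P hP a haP _ (Walk.start_mem_support _) h1)
    · rintro z ⟨h1, h2, h3⟩ ⟨h4, -, -⟩
      rw [Walk.support_reverse, List.mem_reverse] at h4
      exact h3 (aux_split P hP a haP _ h1 h4)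
  obtain ⟨hP1, hP2, hP3⟩ := hsub P hP a haP hax hay
  obtain ⟨hQ1, hQ2, hQ3⟩ := hsub Q hQ b hbQ hbx hby
  have hI : ∀ z, z ∈ interiorSet P → z ≠ x ∧ z ≠ y ∧ z ≠ b := fun z hz =>
    ⟨hz.2.1, hz.2.2, by rintro rfl; exact hdis _ hz hb⟩
  have hJ : ∀ z, z ∈ interiorSet Q → z ≠ x ∧ z ≠ y ∧ z ≠ a := fun z hz =>
    ⟨hz.2.1, hz.2.2, by rintro rfl; exact hdis _ ha hz⟩
  have hE : ∀ z, z ∉ interiorSet hxy.toWalk := by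
    rintro z ⟨h1, h2, h3⟩
    simp at h1
    tauto
  have hK : ∀ z ∈ interiorSet q, z ≠ x ∧ z ≠ y ∧ z ≠ a ∧ z ≠ b := fun z hz =>
    ⟨(hqS z hz.1).1, (hqS z hz.1).2, hz.2.1, hz.2.2⟩
  have hne := hxy.ne
  refine hSP ⟨x, y, a, b, hxy.toWalk, P.takeUntil a haP, Q.takeUntil b hbQ,
    (P.dropUntil a haP).reverse, (Q.dropUntil b hbQ).reverse, q, ?_, ?_, hP.takeUntil haP,
    hQ.takeUntil hbQ, (hP.dropUntil haP).reverse, (hQ.dropUntil hbQ).reverse, hq, ?_, ?_⟩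
  · simp only [List.nodup_cons, List.mem_cons, List.not_mem_nil, or_false, not_or]
    simp only [not_false_eq_true, List.nodup_nil, and_true]
    exact ⟨⟨hne, hax.symm, hbx.symm⟩, ⟨hay.symm, hby.symm⟩, hab⟩
  · simp [hne]
  · simp only [List.pairwise_cons, List.mem_cons, List.not_mem_nil, or_false, forall_eq_or_imp,
      forall_eq, Set.disjoint_left, List.Pairwise.nil, and_true]
    refine ⟨⟨?_, ?_, ?_, ?_, ?_⟩, ⟨?_, ?_, ?_, ?_⟩, ⟨?_, ?_, ?_⟩, ⟨?_, ?_⟩, ?_⟩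
    all_goals grind
  · simp only [List.mem_cons, List.not_mem_nil, or_false, forall_eq_or_imp,
      forall_eq, Set.mem_insert_iff, Set.mem_singleton_iff, not_or]
    refine ⟨?_, ?_, ?_, ?_, ?_, ?_⟩
    all_goals grind

lemma aux_side [Fintype V] (G : SimpleGraph V) (hBi : Biconnected G) {s t : V} (hst : s ≠ t)
    (C : Set V) (hC : ∀ u ∈ C, ∀ w, w ≠ s → w ≠ t → G.Adj u w → w ∈ C)
    (z : V) (hzC : z ∉ C) (hzt : z ≠ t) :
    ∃ q : G.Walk z s, ∀ y ∈ q.support, y = s ∨ y ∉ C := by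
  classical
  obtain ⟨w⟩ := (hBi.2.2 t).preconnected ⟨z, hzt⟩ ⟨s, hst⟩
  have key : ∀ (u v : ({v | v ≠ t} : Set V)) (w : (G.induce {v | v ≠ t}).Walk u v),
      u.1 ∉ C → v.1 = s → ∃ q : G.Walk u.1 s, ∀ y ∈ q.support, y = s ∨ y ∉ C := by
    intro u v w
    induction w with
    | nil =>
      intro h1 h2
      refine ⟨Walk.nil.copy rfl h2, ?_⟩
      intro y hy
      simp at hy
      right
      rw [hy]; exact h1
    | @cons a b c hadj w ih =>
      intro h1 h2
      have hab : G.Adj a.1 b.1 := hadj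
      by_cases has : a.1 = s
      · refine ⟨Walk.nil.copy rfl has, ?_⟩
        intro y hy
        simp at hy
        left
        rw [hy]; exact has
      have hb : b.1 ∉ C := fun hb => h1 (hC _ hb _ has a.2 hab.symm)
      obtain ⟨q, hq⟩ := ih hb h2
      refine ⟨Walk.cons hab q, ?_⟩
      intro y hy
      rw [Walk.support_cons, List.mem_cons] at hy
      rcases hy with rfl | hy
      · exact Or.inr h1
      · exact hq y hy
  exact key _ _ w hzC rfl

lemma aux_chord [Fintype V] (G : SimpleGraph V)
    (hSP : ¬ ContainsK4Subdivision G) (hTr : NoTransitiveEdges G)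
    {s t x y : V} (p₁ : G.Walk s x) (p₂ : G.Walk x y) (p₃ : G.Walk y t)
    (hp : (p₁.append (p₂.append p₃)).IsPath) (C : Set V)
    (hpC : ∀ z ∈ (p₁.append (p₂.append p₃)).support, z = s ∨ z = t ∨ z ∈ C)
    (R : G.Walk s t) (hR : ∀ z ∈ R.support, z = s ∨ z = t ∨ z ∉ C) (hRe : s(s, t) ∉ R.edges)
    (hxy : G.Adj x y) (he : s(x, y) ∉ (p₁.append (p₂.append p₃)).edges) : False := by
  classical
  have hp23 : (p₂.append p₃).IsPath := hp.of_append_right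
  have hp2 : p₂.IsPath := hp23.of_append_left
  simp only [Walk.edges_append, List.mem_append, not_or] at he
  obtain ⟨he1, he2, he3⟩ := he
  have hnd := hp.support_nodup
  rw [Walk.support_append] at hnd
  have d1 := (List.nodup_append.mp hnd).2.2
  have hnd2 := hp23.support_nodup
  rw [Walk.support_append] at hnd2
  have d2 := (List.nodup_append.mp hnd2).2.2
  have d12 : ∀ z ∈ p₁.support, z ∈ p₂.support → z = x := by
    intro z h1 h2
    by_contra hzx
    refine d1 z h1 z ?_ rfl
    have : z ∈ (p₂.append p₃).support := by
      rw [Walk.mem_support_append_iff]; exact Or.inl h2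
    rw [Walk.mem_support_iff] at this
    exact this.resolve_left hzx
  have d23 : ∀ z ∈ p₂.support, z ∈ p₃.support → z = y := by
    intro z h1 h2
    by_contra hzy
    refine d2 z h1 z ?_ rfl
    rw [Walk.mem_support_iff] at h2
    exact h2.resolve_left hzy
  simp only [Walk.mem_support_append_iff] at hpC
  let W : G.Walk x y := p₁.reverse.append (R.append p₃.reverse)
  have hWe : s(x, y) ∉ W.edges := by
    simp only [W, Walk.edges_append, Walk.edges_reverse, List.mem_append, List.mem_reverse,
      not_or]
    refine ⟨he1, ?_, he3⟩
    intro hR'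
    have hx := hR x (Walk.fst_mem_support_of_mem_edges _ hR')
    have hy := hR y (Walk.snd_mem_support_of_mem_edges _ hR')
    have hx' := hpC x (by simp)
    have hy' := hpC y (by simp)
    have hx2 : x = s ∨ x = t := by
      rcases hx with h | h | h
      · exact Or.inl h
      · exact Or.inr h
      · rcases hx' with h' | h' | h'
        exacts [Or.inl h', Or.inr h', absurd h' h]
    have hy2 : y = s ∨ y = t := by
      rcases hy with h | h | h
      · exact Or.inl h
      · exact Or.inr h
      · rcases hy' with h' | h' | h'
        exacts [Or.inl h', Or.inr h', absurd h' h]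
    have hne := hxy.ne
    rcases hx2 with rfl | rfl <;> rcases hy2 with rfl | rfl
    · exact hne rfl
    · exact hRe hR'
    · rw [Sym2.eq_swap] at hR'
      exact hRe hR'
    · exact hne rfl
  refine aux_cycle G hSP hTr hxy p₂ W.bypass hp2 W.bypass_isPath he2
    (fun h => hWe (W.edges_bypass_subset h)) ?_
  rw [Set.disjoint_left]
  rintro z ⟨h1, hzx, hzy⟩ ⟨h2, -, -⟩
  have h2 := W.support_bypass_subset_support h2
  simp only [W, Walk.mem_support_append_iff, Walk.support_reverse, List.mem_reverse] at h2
  rcases h2 with h2 | h2 | h2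
  · exact hzx (d12 z h2 h1)
  · rcases hR z h2 with rfl | rfl | h
    · exact hzx (d12 _ (Walk.start_mem_support _) h1)
    · exact hzy (d23 _ h1 (Walk.end_mem_support _))
    · rcases hpC z (Or.inr (Or.inl h1)) with rfl | rfl | h'
      · exact hzx (d12 _ (Walk.start_mem_support _) h1)
      · exact hzy (d23 _ h1 (Walk.end_mem_support _))
      · exact h h'
  · exact hzy (d23 z h1 h2)

lemma aux_return [Fintype V] (G : SimpleGraph V)
    (hBi : Biconnected G) (hTr : NoTransitiveEdges G)
    (s t : V) (hst : SepPair G s t) (C : Set V) (hC : IsCompAt G s t C) :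
    ∃ R : G.Walk s t, (∀ z ∈ R.support, z = s ∨ z = t ∨ z ∉ C) ∧ s(s, t) ∉ R.edges := by
  obtain ⟨-, hsub, hconn, hcl⟩ := hC
  have hz : ∃ z, z ≠ s ∧ z ≠ t ∧ z ∉ C := by
    by_contra hall
    push Not at hall
    have : C = {v | v ≠ s ∧ v ≠ t} := by
      apply Set.Subset.antisymm hsub
      rintro v ⟨h1, h2⟩
      exact hall v h1 h2
    subst this
    exact hst.2 hconn.preconnected
  obtain ⟨z, hzs, hzt, hzC⟩ := hz
  obtain ⟨q1, h1⟩ := aux_side G hBi hst.1 C (fun u hu w a b h => hcl u hu w ⟨a, b⟩ h) z hzC hzt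
  obtain ⟨q2, h2⟩ := aux_side G hBi hst.1.symm C (fun u hu w a b h => hcl u hu w ⟨b, a⟩ h)
    z hzC hzs
  refine ⟨q1.reverse.append q2, ?_, ?_⟩
  · intro y hy
    simp only [Walk.mem_support_append_iff, Walk.support_reverse, List.mem_reverse] at hy
    rcases hy with hy | hy
    · have := h1 y hy; tauto
    · have := h2 y hy; tauto
  · intro h
    exact hTr s t hst (Walk.adj_of_mem_edges _ h)

/-- In a biconnected series-parallel simple graph without transitive edges, a longest
path between the poles of a component with respect to a separation pair is an induced
path: two of its vertices are adjacent iff they are consecutive on it. -/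
theorem stmt2 [Fintype V] (G : SimpleGraph V)
    (hBi : Biconnected G) (hSP : ¬ ContainsK4Subdivision G)
    (hTr : NoTransitiveEdges G)
    (s t : V) (hst : SepPair G s t)
    (C : Set V) (hC : IsCompAt G s t C)
    (p : G.Walk s t) (hp : p.IsPath)
    (hpC : ∀ x ∈ p.support, x = s ∨ x = t ∨ x ∈ C)
    (hmax : ∀ q : G.Walk s t, q.IsPath →
      (∀ x ∈ q.support, x = s ∨ x = t ∨ x ∈ C) → q.length ≤ p.length) :
    ∀ x ∈ p.support, ∀ y ∈ p.support, (G.Adj x y ↔ s(x, y) ∈ p.edges) := by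
  classical
  intro x hx y hy
  refine ⟨fun hxy => ?_, fun h => Walk.adj_of_mem_edges _ h⟩
  by_contra he
  obtain ⟨R, hR, hRe⟩ := aux_return G hBi hTr s t hst C hC
  have hspec := p.take_spec hx
  have hy' := hy
  rw [← hspec, Walk.mem_support_append_iff] at hy'
  rcases hy' with hy' | hy'
  · have hs2 : ((p.takeUntil x hx).takeUntil y hy').append
        (((p.takeUntil x hx).dropUntil y hy').append (p.dropUntil x hx)) = p := by
      rw [Walk.append_assoc, Walk.take_spec, hspec]
    rw [Sym2.eq_swap] at he
    exact aux_chord G hSP hTr _ _ _ (by rw [hs2]; exact hp) C (by rw [hs2]; exact hpC)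
      R hR hRe hxy.symm (by rw [hs2]; exact he)
  · have hs2 : (p.takeUntil x hx).append
        (((p.dropUntil x hx).takeUntil y hy').append ((p.dropUntil x hx).dropUntil y hy')) = p := by
      rw [Walk.take_spec, hspec]
    exact aux_chord G hSP hTr _ _ _ (by rw [hs2]; exact hp) C (by rw [hs2]; exact hpC)
      R hR hRe hxy (by rw [hs2]; exact he)
end

section
/- Let G be a biconnected series-parallel simple graph with no transitive edges, let (s,t) be a separation pair of G, let G₁ be a component of G with respect to (s,t), and let p be a path from s to t all of whose vertices belong to G₁ of maximum length (number of edges) among all such paths. Then for every connected component C of the graph obtained from G₁ by deleting the vertices of p, exactly two vertices of p have a neighbor in C. -/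
open SimpleGraph

variable {V : Type*}

theorem walk_of_induce {G : SimpleGraph V} {S : Set V} (h : (G.induce S).Preconnected)
    {u v : V} (hu : u ∈ S) (hv : v ∈ S) : ∃ q : G.Walk u v, ∀ x ∈ q.support, x ∈ S := by
  obtain ⟨w⟩ := h ⟨u, hu⟩ ⟨v, hv⟩
  refine ⟨w.map (SimpleGraph.Embedding.induce S).toHom, ?_⟩
  intro x hx
  obtain ⟨y, _, rfl⟩ := List.mem_map.mp ((Walk.support_map _ w) ▸ hx)
  exact y.2

theorem path_of_induce {G : SimpleGraph V} {S : Set V} (h : (G.induce S).Preconnected)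
    {u v : V} (hu : u ∈ S) (hv : v ∈ S) :
    ∃ q : G.Walk u v, q.IsPath ∧ ∀ x ∈ q.support, x ∈ S := by
  classical
  obtain ⟨q, hq⟩ := walk_of_induce h hu hv
  exact ⟨q.bypass, q.bypass_isPath, fun x hx => hq x (q.support_bypass_subset hx)⟩

theorem isPath_append_iff' {G : SimpleGraph V} {u v w : V} (q : G.Walk u v) (r : G.Walk v w) :
    (q.append r).IsPath ↔ q.IsPath ∧ r.IsPath ∧ ∀ x ∈ q.support, x ∈ r.support → x = v := by
  have hr : r.support = v :: r.support.tail := r.support_eq_cons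
  have hv : v ∈ q.support := q.end_mem_support
  simp only [Walk.isPath_def, Walk.support_append]
  rw [List.nodup_append]
  generalize r.support.tail = l at *
  rw [hr]
  grind

theorem first_split {G : SimpleGraph V} (P : V → Prop) {u v : V} (p : G.Walk u v) :
    (∃ x ∈ p.support, P x) →
    ∃ (a : V) (q : G.Walk u a) (r : G.Walk a v), p = q.append r ∧ P a ∧
      ∀ x ∈ q.support, P x → x = a := by
  classical
  induction p with
  | nil =>
    rintro ⟨x, hx, hP⟩
    simp at hx
    subst hx
    exact ⟨_, Walk.nil, Walk.nil, rfl, hP, by simp⟩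
  | @cons u w v h p ih =>
    rintro ⟨x, hx, hP⟩
    by_cases hu : P u
    · exact ⟨u, Walk.nil, Walk.cons h p, rfl, hu, by simp⟩
    · obtain ⟨a, q, r, rfl, ha, hq⟩ := ih ⟨x, by
        rw [Walk.support_cons, List.mem_cons] at hx
        rcases hx with rfl | hx
        · exact absurd hP hu
        · exact hx, hP⟩
      refine ⟨a, Walk.cons h q, r, rfl, ha, ?_⟩
      intro y hy hPy
      rw [Walk.support_cons, List.mem_cons] at hy
      rcases hy with rfl | hy
      · exact absurd hPy hu
      · exact hq y hy hPy

theorem split3 {G : SimpleGraph V} (P : V → Prop) {u v : V} (p : G.Walk u v) (x y z : V)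
    (hx : x ∈ p.support) (hy : y ∈ p.support) (hz : z ∈ p.support)
    (hPx : P x) (hPy : P y) (hPz : P z) (hxy : x ≠ y) (hxz : x ≠ z) (hyz : y ≠ z) :
    ∃ (a b c : V) (p1 : G.Walk u a) (p2 : G.Walk a b) (p3 : G.Walk b c) (p4 : G.Walk c v),
      p = p1.append (p2.append (p3.append p4)) ∧ P a ∧ P b ∧ P c ∧ a ≠ b ∧ a ≠ c ∧ b ≠ c := by
  obtain ⟨a, p1, r, rfl, ha, h1⟩ := first_split P p ⟨x, hx, hPx⟩
  have ar : a ∈ r.support := r.start_mem_support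
  simp only [Walk.mem_support_append_iff] at hx hy hz
  have hx' : x ∈ r.support := by grind
  have hy' : y ∈ r.support := by grind
  have hz' : z ∈ r.support := by grind
  obtain ⟨b, p2, r2, rfl, ⟨hb, hba⟩, h2⟩ := first_split (fun x => P x ∧ x ≠ a) r (by
    by_cases x = a
    · exact ⟨y, by grind⟩
    · exact ⟨x, by grind⟩)
  have br : b ∈ r2.support := r2.start_mem_support
  simp only [Walk.mem_support_append_iff] at hx' hy' hz'
  obtain ⟨c, p3, p4, rfl, ⟨hc, hca, hcb⟩, h3⟩ :=
    first_split (fun x => P x ∧ x ≠ a ∧ x ≠ b) r2 (by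
    by_cases x = a ∨ x = b
    · by_cases y = a ∨ y = b
      · exact ⟨z, by grind⟩
      · exact ⟨y, by grind⟩
    · exact ⟨x, by grind⟩)
  exact ⟨a, b, c, p1, p2, p3, p4, rfl, ha, hb, hc, hba.symm, hca.symm, hcb.symm⟩

/-- Three disjoint legs from a vertex of a connected set. -/
theorem claw {G : SimpleGraph V} {S : Set V} (h : (G.induce S).Preconnected)
    {x y z : V} (hx : x ∈ S) (hy : y ∈ S) (hz : z ∈ S) :
    ∃ (v : V) (qx : G.Walk x v) (qy : G.Walk y v) (qz : G.Walk z v),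
      qx.IsPath ∧ qy.IsPath ∧ qz.IsPath ∧
      (∀ w ∈ qx.support, w ∈ S) ∧ (∀ w ∈ qy.support, w ∈ S) ∧ (∀ w ∈ qz.support, w ∈ S) ∧
      (∀ w ∈ qx.support, w ∈ qy.support → w = v) ∧
      (∀ w ∈ qx.support, w ∈ qz.support → w = v) ∧
      (∀ w ∈ qy.support, w ∈ qz.support → w = v) := by
  obtain ⟨P, hP, hPS⟩ := path_of_induce h hx hy
  obtain ⟨Q, hQ, hQS⟩ := path_of_induce h hz hx
  obtain ⟨v, q, r, rfl, hv, hq⟩ := first_split (· ∈ P.support) Q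
    ⟨x, Q.end_mem_support, P.start_mem_support⟩
  obtain ⟨v', q1, q2, rfl, rfl, -⟩ := first_split (· = v) P ⟨v, hv, rfl⟩
  rw [isPath_append_iff'] at hP hQ
  obtain ⟨h1, h2, h3⟩ := hP
  simp only [Walk.mem_support_append_iff] at *
  refine ⟨v', q1, q2.reverse, q, h1, h2.reverse, hQ.1, ?_, ?_, ?_, ?_, ?_, ?_⟩ <;>
    (try simp only [Walk.support_reverse, List.mem_reverse]) <;> grind

theorem outer_walk {G : SimpleGraph V} {s t : V} {C : Set V} (hs : s ∉ C)
    (hcl : ∀ u ∈ C, ∀ w, w ≠ s → w ≠ t → G.Adj u w → w ∈ C) {w r : V} (q : G.Walk w r) :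
    r = s → t ∉ q.support → w ∉ C → ∃ q' : G.Walk w s, ∀ x ∈ q'.support, x ∉ C := by
  induction q with
  | nil => rintro rfl _ _; exact ⟨Walk.nil, by simpa using hs⟩
  | @cons u w v h p ih =>
    intro hv ht hu
    by_cases hus : u = s
    · subst hus; exact ⟨Walk.nil, by simpa using hs⟩
    · rw [Walk.support_cons, List.mem_cons, not_or] at ht
      obtain ⟨q', hq'⟩ := ih hv ht.2 (fun hw => hu (hcl w hw u hus (Ne.symm ht.1) h.symm))
      refine ⟨Walk.cons h q', ?_⟩
      intro x hx
      rw [Walk.support_cons, List.mem_cons] at hx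
      rcases hx with rfl | hx
      · exact hu
      · exact hq' x hx

theorem stay {G : SimpleGraph V} {S : Set V} {x : V}
    (hcl : ∀ u ∈ S, ∀ w, w ≠ x → G.Adj u w → w ∈ S) {w r : V} (q : G.Walk w r) :
    x ∉ q.support → w ∈ S → r ∈ S := by
  induction q with
  | nil => intro _ h; exact h
  | @cons u w v h p ih =>
    intro hx hu
    rw [Walk.support_cons, List.mem_cons, not_or] at hx
    refine ih hx.2 (hcl u hu w ?_ h)
    rintro rfl
    exact hx.2 p.start_mem_support

theorem outer_path [Fintype V] {G : SimpleGraph V} (hBi : Biconnected G) {s t : V}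
    (hst : SepPair G s t) {C : Set V} (hC : IsCompAt G s t C) :
    ∃ R : G.Walk s t, R.IsPath ∧ ∀ x ∈ R.support, x ∉ C := by
  classical
  obtain ⟨hne, hnp⟩ := hst
  obtain ⟨_, hsub, hcon, hcl⟩ := hC
  have hs : s ∉ C := fun h => (hsub h).1 rfl
  have ht : t ∉ C := fun h => (hsub h).2 rfl
  obtain ⟨w, hw, hwC⟩ : ∃ w, (w ≠ s ∧ w ≠ t) ∧ w ∉ C := by
    by_contra hcon'
    push Not at hcon'
    have : C = {v | v ≠ s ∧ v ≠ t} := Set.Subset.antisymm hsub (fun v hv => hcon' v hv)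
    rw [← this] at hnp
    exact hnp hcon.preconnected
  obtain ⟨q1, h1⟩ := walk_of_induce (hBi.2.2 t).preconnected (u := w) (v := s) hw.2 hne
  obtain ⟨q2, h2⟩ := walk_of_induce (hBi.2.2 s).preconnected (u := w) (v := t) hw.1 hne.symm
  obtain ⟨r1, g1⟩ := outer_walk (t := t) hs (fun u hu w a b h => hcl u hu w ⟨a, b⟩ h) q1 rfl
    (fun h => h1 t h rfl) hwC
  obtain ⟨r2, g2⟩ := outer_walk (t := s) ht (fun u hu w a b h => hcl u hu w ⟨b, a⟩ h) q2 rfl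
    (fun h => h2 s h rfl) hwC
  refine ⟨(r1.reverse.append r2).bypass, Walk.bypass_isPath _, fun x hx => ?_⟩
  have := Walk.support_bypass_subset _ hx
  rw [Walk.mem_support_append_iff, Walk.support_reverse, List.mem_reverse] at this
  rcases this with h | h
  · exact g1 x h
  · exact g2 x h

theorem stmt3 [Fintype V] (G : SimpleGraph V)
    (hBi : Biconnected G) (hSP : ¬ ContainsK4Subdivision G)
    (hTr : NoTransitiveEdges G)
    (s t : V) (hst : SepPair G s t)
    (C : Set V) (hC : IsCompAt G s t C)
    (p : G.Walk s t) (hp : p.IsPath)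
    (hpC : ∀ x ∈ p.support, x = s ∨ x = t ∨ x ∈ C)
    (hmax : ∀ q : G.Walk s t, q.IsPath →
      (∀ x ∈ q.support, x = s ∨ x = t ∨ x ∈ C) → q.length ≤ p.length)
    (C' : Set V)
    (hC' : IsCCOf G ((C ∪ {s, t}) \ {x | x ∈ p.support}) C') :
    {x | x ∈ p.support ∧ ∃ y ∈ C', G.Adj x y}.ncard = 2 := by
  classical
  obtain ⟨R, hR, hRC⟩ := outer_path hBi hst hC
  obtain ⟨⟨y0, hy0⟩, hsub', hcon', hcl'⟩ := hC'
  obtain ⟨_, hsub, hcon, hcl⟩ := hC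
  have hsp : s ∈ p.support := p.start_mem_support
  have htp : t ∈ p.support := p.end_mem_support
  have hC'p : ∀ x ∈ C', x ∉ p.support := fun x hx => (hsub' hx).2
  have hC'C : ∀ x ∈ C', x ∈ C := by
    intro x hx
    have h1 := hsub' hx
    rcases h1.1 with h | h | h
    · exact h
    · exact absurd (h ▸ hsp) h1.2
    · exact absurd ((show x = t from h) ▸ htp) h1.2
  apply le_antisymm
  · by_contra hlt
    push Not at hlt
    rw [Set.two_lt_ncard_iff (Set.toFinite _)] at hlt
    obtain ⟨x, y, z, ⟨hx, hPx⟩, ⟨hy, hPy⟩, ⟨hz, hPz⟩, hxy, hxz, hyz⟩ := hlt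
    obtain ⟨a, b, c, p1, p2, p3, p4, rfl, ⟨x', hx', ax⟩, ⟨y', hy', byy⟩, ⟨z', hz', cz⟩,
      hab, hac, hbc⟩ := split3 (fun x => ∃ y ∈ C', G.Adj x y) p x y z hx hy hz hPx hPy hPz
        hxy hxz hyz
    clear hx hPx hy hPy hz hPz hxy hxz hyz hmax hTr
    obtain ⟨v, qx, qy, qz, hqx, hqy, hqz, sx, sy, sz, dxy, dxz, dyz⟩ :=
      claw hcon'.preconnected hx' hy' hz'
    have hv : v ∈ C' := sx v qx.end_mem_support
    have s1 := p1.start_mem_support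
    have e1 := p1.end_mem_support
    have s2 := p2.start_mem_support
    have e2 := p2.end_mem_support
    have s3 := p3.start_mem_support
    have e3 := p3.end_mem_support
    have s4 := p4.start_mem_support
    have e4 := p4.end_mem_support
    simp only [isPath_append_iff', Walk.mem_support_append_iff] at hp hpC hC'p
    obtain ⟨hp1, ⟨hp2, ⟨hp3, hp4, d34⟩, d2⟩, d1⟩ := hp
    have hsC : s ∉ C := fun h => (hsub h).1 rfl
    have htC : t ∉ C := fun h => (hsub h).2 rfl
    apply hSP
    refine ⟨a, b, c, v, p2, p1.reverse.append (R.append p4.reverse), Walk.cons ax qx, p3,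
      Walk.cons byy qy, Walk.cons cz qz, ?_, hp2, ?_, ?_, hp3, ?_, ?_, ?_, ?_⟩
    · simp; grind
    · simp only [isPath_append_iff', Walk.isPath_reverse_iff, Walk.mem_support_append_iff,
        Walk.support_reverse, List.mem_reverse]
      refine ⟨hp1, ⟨hR, hp4, ?_⟩, ?_⟩ <;> grind
    · rw [Walk.cons_isPath_iff]; grind
    · rw [Walk.cons_isPath_iff]; grind
    · rw [Walk.cons_isPath_iff]; grind
    · simp only [interiorSet, List.pairwise_cons, List.mem_cons, Set.disjoint_left,
        Walk.mem_support_append_iff, Walk.support_reverse, List.mem_reverse, Walk.support_cons,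
        Set.mem_setOf_eq, forall_eq_or_imp, List.not_mem_nil]
      refine ⟨⟨?_, ?_, ?_, ?_, ?_, ?_⟩, ⟨?_, ?_, ?_, ?_, ?_⟩, ⟨?_, ?_, ?_, ?_⟩, ⟨?_, ?_, ?_⟩,
        ⟨?_, ?_⟩, ?_⟩ <;> grind
    · simp only [interiorSet, List.mem_cons, 
        Walk.mem_support_append_iff, Walk.support_reverse, List.mem_reverse, Walk.support_cons,
        Set.mem_setOf_eq, forall_eq_or_imp, List.not_mem_nil, Set.mem_insert_iff,
        Set.mem_singleton_iff]
      refine ⟨?_, ?_, ?_, ?_, ?_, ?_, ?_⟩ <;> grind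
  · by_contra hlt
    push Not at hlt
    obtain ⟨x, hxp, hx⟩ : ∃ x, x ∈ p.support ∧
        ∀ w ∈ p.support, (∃ y ∈ C', G.Adj w y) → w = x := by
      have h1 := Nat.lt_succ_iff.mp hlt
      rw [Set.ncard_le_one (Set.toFinite _)] at h1
      by_cases he : ∃ x ∈ p.support, ∃ y ∈ C', G.Adj x y
      · obtain ⟨x, hx, hy⟩ := he
        exact ⟨x, hx, fun w hw hwy => h1 w ⟨hw, hwy⟩ x ⟨hx, hy⟩⟩
      · exact ⟨s, hsp, fun w hw hwy => absurd ⟨w, hw, hwy⟩ he⟩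
    obtain ⟨r, hrp, hrx⟩ : ∃ r ∈ p.support, r ≠ x := by
      by_cases h : s = x
      · exact ⟨t, htp, fun h' => hst.1 (h.trans h'.symm)⟩
      · exact ⟨s, hsp, h⟩
    obtain ⟨q, hq⟩ := walk_of_induce (hBi.2.2 x).preconnected (u := y0) (v := r)
      (fun h => hC'p y0 hy0 (h ▸ hxp)) hrx
    refine hC'p r (stay (S := C') (x := x) ?_ q (fun h => hq x h rfl) hy0) hrp
    intro u hu w hwx huw
    have hwp : w ∉ p.support := fun h => hwx (hx w h ⟨u, hu, huw.symm⟩)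
    refine hcl' u hu w ⟨Or.inl (hcl u (hC'C u hu) w ⟨?_, ?_⟩ huw), hwp⟩ huw
    · rintro rfl; exact hwp hsp
    · rintro rfl; exact hwp htp
end

section
/- Let G be a biconnected series-parallel simple graph with no transitive edges, let (s,t) be a separation pair of G, and let G' be a component of G with respect to (s,t). If some internal vertex v of G' is adjacent to both s and t, then v is the only internal vertex of G'. -/
open SimpleGraph

variable {V : Type*}

/-- any two vertices of `D` are joined by a walk inside `D` -/
def WConn (G : SimpleGraph V) (D : Set V) : Prop :=
  ∀ x ∈ D, ∀ y ∈ D, ∃ w : G.Walk x y, ∀ z ∈ w.support, z ∈ D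

lemma wconn_iff (G : SimpleGraph V) (D : Set V) :
    (G.induce D).Preconnected ↔ WConn G D := by
  constructor
  · intro h x hx y hy
    obtain ⟨w⟩ := h ⟨x, hx⟩ ⟨y, hy⟩
    refine ⟨w.map (Embedding.induce D).toHom, ?_⟩
    intro z hz
    have hz2 := (Walk.support_map (Embedding.induce D).toHom w) ▸ hz
    rw [List.mem_map] at hz2
    obtain ⟨a, -, rfl⟩ := hz2
    exact a.2
  · rintro h ⟨x, hx⟩ ⟨y, hy⟩
    obtain ⟨w, hw⟩ := h x hx y hy
    exact ⟨w.induce D hw⟩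

lemma exists_comp (G : SimpleGraph V) (E : Set V) (x : V) (hx : x ∈ E) :
    ∃ C, C ⊆ E ∧ x ∈ C ∧ WConn G C ∧ ∀ u ∈ C, ∀ w ∈ E, G.Adj u w → w ∈ C := by
  classical
  refine ⟨{y | ∃ w : G.Walk x y, ∀ z ∈ w.support, z ∈ E}, ?_, ?_, ?_, ?_⟩
  · rintro y ⟨w, hw⟩
    exact hw _ w.end_mem_support
  · exact ⟨Walk.nil, by simpa using hx⟩
  · rintro y ⟨w, hw⟩ z ⟨w', hw'⟩
    refine ⟨w.reverse.append w', ?_⟩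
    intro u hu
    rw [Walk.mem_support_append_iff] at hu
    rcases hu with hu | hu
    · rw [Walk.support_reverse, List.mem_reverse] at hu
      exact ⟨w.takeUntil u hu, fun a ha => hw _ (w.support_takeUntil_subset_support hu ha)⟩
    · exact ⟨w'.takeUntil u hu, fun a ha => hw' _ (w'.support_takeUntil_subset_support hu ha)⟩
  · rintro u ⟨w, hw⟩ y hy h
    refine ⟨w.concat h, ?_⟩
    intro z hz
    rw [Walk.support_concat, List.mem_append] at hz
    rcases hz with hz | hz
    · exact hw _ hz
    · simp at hz; subst hz; exact hy

lemma boundary (G : SimpleGraph V) {E D : Set V} (hE : WConn G E) {x y : V}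
    (hx : x ∈ E) (hy : y ∈ E) (hxD : x ∈ D) (hyD : y ∉ D) :
    ∃ u ∈ D, ∃ w ∈ E, w ∉ D ∧ G.Adj u w := by
  obtain ⟨p, hp⟩ := hE x hx y hy
  obtain ⟨d, hd, h1, h2⟩ := p.exists_boundary_dart D hxD hyD
  exact ⟨d.fst, h1, d.snd, hp _ (p.dart_snd_mem_support_of_mem_darts hd), h2, d.adj⟩

lemma first_hit (G : SimpleGraph V) (S : Set V) {u x : V} (w : G.Walk u x) (hx : x ∈ S) :
    ∃ m ∈ S, ∃ p : G.Walk u m, (∀ z ∈ p.support, z ∈ w.support) ∧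
      ∀ z ∈ p.support, z ∈ S → z = m := by
  induction w with
  | nil => exact ⟨_, hx, Walk.nil, by simp, by simp⟩
  | @cons a b c h w ih =>
    by_cases ha : a ∈ S
    · exact ⟨a, ha, Walk.nil, by simp, by simp⟩
    · obtain ⟨m, hm, p, h1, h2⟩ := ih hx
      refine ⟨m, hm, Walk.cons h p, ?_, ?_⟩
      · intro z hz
        rw [Walk.support_cons, List.mem_cons] at hz ⊢
        exact hz.imp_right (h1 z)
      · intro z hz hzS
        rw [Walk.support_cons, List.mem_cons] at hz
        rcases hz with rfl | hz
        · exact absurd hzS ha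
        · exact h2 z hz hzS

/-- A path from `a` to `b` through `D`. -/
lemma path_through (G : SimpleGraph V) {D : Set V} (hD : WConn G D) {a b x y : V}
    (ha : a ∉ D) (hb : b ∉ D) (hab : a ≠ b) (hx : x ∈ D) (hy : y ∈ D)
    (hax : G.Adj a x) (hby : G.Adj b y) :
    ∃ p : G.Walk a b, p.IsPath ∧ x ∈ p.support ∧ ∀ z ∈ p.support, z = a ∨ z = b ∨ z ∈ D := by
  classical
  obtain ⟨w, hw⟩ := hD x hx y hy
  have hw' : ∀ z ∈ w.bypass.support, z ∈ D := fun z hz => hw z (w.support_bypass_subset_support hz)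
  refine ⟨Walk.cons hax (w.bypass.concat hby.symm), ?_, ?_, ?_⟩
  · rw [Walk.cons_isPath_iff]
    refine ⟨(w.bypass_isPath).concat (fun h => hb (hw' _ h)) _, ?_⟩
    rw [Walk.support_concat, List.mem_append]
    rintro (h | h)
    · exact ha (hw' _ h)
    · simp at h; exact hab h
  · simp
  · intro z hz
    rw [Walk.support_cons, List.mem_cons, Walk.support_concat,
      List.mem_append] at hz
    rcases hz with h | h | h
    · exact Or.inl h
    · exact Or.inr (Or.inr (hw' _ h))
    · simp at h; exact Or.inr (Or.inl h)

lemma tripod (G : SimpleGraph V) {D : Set V} (hD : WConn G D) {a b c x y z : V}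
    (ha : a ∉ D) (hb : b ∉ D) (hc : c ∉ D) (hab : a ≠ b)
    (hx : x ∈ D) (hy : y ∈ D) (hz : z ∈ D)
    (hax : G.Adj a x) (hby : G.Adj b y) (hcz : G.Adj c z) :
    ∃ m ∈ D, ∃ (p : G.Walk a m) (q : G.Walk b m) (r : G.Walk c m),
      p.IsPath ∧ q.IsPath ∧ r.IsPath ∧ interiorSet p ⊆ D ∧ interiorSet q ⊆ D ∧
      interiorSet r ⊆ D ∧ Disjoint (interiorSet p) (interiorSet q) ∧
      Disjoint (interiorSet p) (interiorSet r) ∧ Disjoint (interiorSet q) (interiorSet r) := by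
  classical
  obtain ⟨P, hP, hxP, hPD⟩ := path_through G hD ha hb hab hx hy hax hby
  obtain ⟨Q, hQ⟩ := hD z hz x hx
  obtain ⟨m, hm, R, hR1, hR2⟩ := first_hit G {u | u ∈ P.support} Q hxP
  have hRD : ∀ u ∈ R.bypass.support, u ∈ D :=
    fun u hu => hQ _ (hR1 _ (R.support_bypass_subset_support hu))
  have hRm : ∀ u ∈ R.bypass.support, u ∈ P.support → u = m :=
    fun u hu h => hR2 u (R.support_bypass_subset_support hu) h
  have hmD : m ∈ D := hRD m (Walk.end_mem_support _)
  have hm' : m ∈ P.support := hm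
  have hPP : ∀ u, u ∈ (P.takeUntil m hm').support → u ∈ (P.dropUntil m hm').support → u = m := by
    intro u h1 h2
    by_contra hne
    have h3 := hP
    rw [← P.take_spec hm', Walk.isPath_def, Walk.support_append, List.nodup_append] at h3
    rw [Walk.mem_support_iff] at h2
    rcases h2 with h2 | h2
    · exact hne h2
    · exact h3.2.2 u h1 u h2 rfl
  have hT : ∀ u ∈ (P.takeUntil m hm').support, u ∈ P.support :=
    fun u hu => P.support_takeUntil_subset_support hm' hu
  have hDr : ∀ u ∈ (P.dropUntil m hm').support, u ∈ P.support :=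
    fun u hu => P.support_dropUntil_subset_support hm' hu
  have hbm : b ≠ m := fun h => hb (h ▸ hmD)
  have ham : a ≠ m := fun h => ha (h ▸ hmD)
  have hbT : b ∉ (P.takeUntil m hm').support := fun h =>
    hbm (hPP b h (Walk.end_mem_support _))
  have haT : a ∉ (P.dropUntil m hm').support := fun h =>
    ham (hPP a (Walk.start_mem_support _) h)
  refine ⟨m, hmD, P.takeUntil m hm', (P.dropUntil m hm').reverse, Walk.cons hcz R.bypass,
    hP.takeUntil _, (hP.dropUntil _).reverse, ?_, ?_, ?_, ?_, ?_, ?_, ?_⟩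
  · rw [Walk.cons_isPath_iff]
    exact ⟨R.bypass_isPath, fun h => hc (hRD _ h)⟩
  · rintro u ⟨h1, h2, h3⟩
    rcases hPD u (hT u h1) with h | h | h
    · exact absurd h h2
    · subst h; exact absurd h1 hbT
    · exact h
  · rintro u ⟨h1, h2, h3⟩
    rw [Walk.support_reverse, List.mem_reverse] at h1
    rcases hPD u (hDr u h1) with h | h | h
    · subst h; exact absurd h1 haT
    · exact absurd h h2
    · exact h
  · rintro u ⟨h1, h2, h3⟩
    rw [Walk.support_cons, List.mem_cons] at h1
    exact hRD _ (h1.resolve_left h2)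
  · rw [Set.disjoint_left]
    rintro u ⟨h1, h2, h3⟩ ⟨h4, -, -⟩
    rw [Walk.support_reverse, List.mem_reverse] at h4
    exact h3 (hPP u h1 h4)
  · rw [Set.disjoint_left]
    rintro u ⟨h1, h2, h3⟩ ⟨h4, h5, -⟩
    rw [Walk.support_cons, List.mem_cons] at h4
    exact h3 (hRm u (h4.resolve_left h5) (hT u h1))
  · rw [Set.disjoint_left]
    rintro u ⟨h1, h2, h3⟩ ⟨h4, h5, -⟩
    rw [Walk.support_reverse, List.mem_reverse] at h1
    rw [Walk.support_cons, List.mem_cons] at h4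
    exact h3 (hRm u (h4.resolve_left h5) (hDr u h1))

lemma interior_edge (G : SimpleGraph V) {a b : V} (h : G.Adj a b) :
    interiorSet h.toWalk = ∅ := by
  ext z
  simp [interiorSet]
  tauto

lemma isPath_edge (G : SimpleGraph V) {a b : V} (h : G.Adj a b) : h.toWalk.IsPath := by
  simp [h.ne]

/-- In a biconnected series-parallel simple graph without transitive edges, if an
internal vertex of a component w.r.t. a separation pair `(s, t)` is adjacent to both
poles, then it is the only internal vertex of the component. -/
theorem stmt5 [Fintype V] (G : SimpleGraph V)
    (hBi : Biconnected G) (hSP : ¬ ContainsK4Subdivision G)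
    (hTr : NoTransitiveEdges G)
    (s t : V) (hst : SepPair G s t)
    (C : Set V) (hC : IsCompAt G s t C)
    (v : V) (hv : v ∈ C) (hvs : G.Adj v s) (hvt : G.Adj v t) :
    C = {v} := by
  obtain ⟨-, hCE, hCc, hCcl⟩ := hC
  have hCW : WConn G C := (wconn_iff G C).1 hCc.preconnected
  by_contra hne
  have hsC : s ∉ C := fun h => (hCE h).1 rfl
  have htC : t ∉ C := fun h => (hCE h).2 rfl
  obtain ⟨x, hxC, hxv⟩ : ∃ x ∈ C, x ≠ v := by
    by_contra hcon
    push Not at hcon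
    exact hne (Set.eq_singleton_iff_unique_mem.2 ⟨hv, hcon⟩)
  obtain ⟨y, hyE, hyC⟩ : ∃ y ∈ {v : V | v ≠ s ∧ v ≠ t}, y ∉ C := by
    by_contra hcon
    push Not at hcon
    have hEq : {v : V | v ≠ s ∧ v ≠ t} = C := Set.Subset.antisymm hcon hCE
    apply hst.2
    rw [wconn_iff, hEq]
    exact hCW
  obtain ⟨C', hC'E, hyC', hC'W, hC'cl⟩ := exists_comp G _ y hyE
  have hdisj : ∀ u ∈ C, u ∉ C' := by
    intro u hu hu'
    obtain ⟨a, ha, b, hb, hbC, hab⟩ := boundary G hC'W hu' hyC' hu hyC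
    exact hbC (hCcl a ha b (hC'E hb) hab)
  have hW : ∀ z, WConn G {u | u ≠ z} := fun z => (wconn_iff G _).1 (hBi.2.2 z).preconnected
  obtain ⟨xs, hxs, hxs'⟩ : ∃ u ∈ C', G.Adj s u := by
    obtain ⟨a, ha, b, hb, hbC, hab⟩ := boundary G (hW t) (x := y) (y := v) hyE.2 (hCE hv).2
      hyC' (hdisj v hv)
    have : b = s := by
      by_contra h
      exact hbC (hC'cl a ha b ⟨h, hb⟩ hab)
    exact ⟨a, ha, this ▸ hab.symm⟩
  obtain ⟨xt, hxt, hxt'⟩ : ∃ u ∈ C', G.Adj t u := by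
    obtain ⟨a, ha, b, hb, hbC, hab⟩ := boundary G (hW s) (x := y) (y := v) hyE.1 (hCE hv).1
      hyC' (hdisj v hv)
    have : b = t := by
      by_contra h
      exact hbC (hC'cl a ha b ⟨hb, h⟩ hab)
    exact ⟨a, ha, this ▸ hab.symm⟩
  obtain ⟨pst, hpst, -, hpstC⟩ := path_through G hC'W (fun h => (hC'E h).1 rfl)
    (fun h => (hC'E h).2 rfl) hst.1 hxs hxt hxs' hxt'
  obtain ⟨D, hDE, hxD, hDW, hDcl⟩ := exists_comp G {u | u ∈ C ∧ u ≠ v} x ⟨hxC, hxv⟩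
  have hvD : v ∉ D := fun h => (hDE h).2 rfl
  have hsD : s ∉ D := fun h => hsC (hDE h).1
  have htD : t ∉ D := fun h => htC (hDE h).1
  have hDn : ∀ u ∈ D, ∀ w, G.Adj u w → w ∉ D → w = s ∨ w = t ∨ w = v := by
    intro u hu w huw hw
    by_contra hcon
    push Not at hcon
    exact hw (hDcl u hu w ⟨hCcl u (hDE hu).1 w ⟨hcon.1, hcon.2.1⟩ huw, hcon.2.2⟩ huw)
  obtain ⟨dv, hdv, hdv'⟩ : ∃ u ∈ D, G.Adj v u := by
    obtain ⟨a, ha, b, hb, hbD, hab⟩ := boundary G hCW hxC hv hxD hvD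
    rcases hDn a ha b hab hbD with rfl | rfl | rfl
    · exact absurd hb hsC
    · exact absurd hb htC
    · exact ⟨a, ha, hab.symm⟩
  obtain ⟨ds, hds, hds'⟩ : ∃ u ∈ D, G.Adj s u := by
    by_contra hcon
    push Not at hcon
    refine hTr v t ⟨hvt.ne, fun hpre => ?_⟩ hvt
    obtain ⟨a, ha, b, hb, hbD, hab⟩ := boundary G ((wconn_iff G _).1 hpre) (x := x) (y := s)
      ⟨hxv, (hCE hxC).2⟩ ⟨hvs.ne.symm, hst.1⟩ hxD hsD
    rcases hDn a ha b hab hbD with rfl | rfl | rfl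
    · exact hcon a ha hab.symm
    · exact hb.2 rfl
    · exact hb.1 rfl
  obtain ⟨dt, hdt, hdt'⟩ : ∃ u ∈ D, G.Adj t u := by
    by_contra hcon
    push Not at hcon
    refine hTr v s ⟨hvs.ne, fun hpre => ?_⟩ hvs
    obtain ⟨a, ha, b, hb, hbD, hab⟩ := boundary G ((wconn_iff G _).1 hpre) (x := x) (y := t)
      ⟨hxv, (hCE hxC).1⟩ ⟨hvt.ne.symm, hst.1.symm⟩ hxD htD
    rcases hDn a ha b hab hbD with rfl | rfl | rfl
    · exact hb.2 rfl
    · exact hcon a ha hab.symm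
    · exact hb.1 rfl
  obtain ⟨m, hmD, p, q, r, hp, hq, hr, hpD, hqD, hrD, hpq, hpr, hqr⟩ :=
    tripod G hDW hsD htD hvD hst.1 hds hdt hdv hds' hdt' hdv'
  have hI : interiorSet pst ⊆ C' := by
    rintro u ⟨h1, h2, h3⟩
    rcases hpstC u h1 with h | h | h
    · exact absurd h h2
    · exact absurd h h3
    · exact h
  have hC'D : Disjoint C' D := Set.disjoint_left.2 fun u hu hu' => hdisj u (hDE hu').1 hu
  have hsm : s ≠ m := fun h => hsD (h ▸ hmD)
  have htm : t ≠ m := fun h => htD (h ▸ hmD)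
  have hvm : v ≠ m := fun h => hvD (h ▸ hmD)
  have hDx : ∀ {w : V} (p : G.Walk w m), interiorSet p ⊆ D →
      ∀ u ∈ interiorSet p, u ∉ ({s, t, v, m} : Set V) := by
    rintro w p hp u hu (h | h | h | h)
    · exact hsD (h ▸ hp hu)
    · exact htD (h ▸ hp hu)
    · exact hvD (h ▸ hp hu)
    · exact hu.2.2 h
  have hCx : ∀ u ∈ interiorSet pst, u ∉ ({s, t, v, m} : Set V) := by
    rintro u hu (h | h | h | h)
    · exact hu.2.1 h
    · exact hu.2.2 h
    · exact hdisj v hv (h ▸ hI hu)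
    · exact hdisj m (hDE hmD).1 (h ▸ hI hu)
  refine hSP ⟨s, t, v, m, pst, hvs.symm.toWalk, p, hvt.symm.toWalk, q, r, ?_, hpst,
    isPath_edge G _, hp, isPath_edge G _, hq, hr, ?_, ?_⟩
  · simp [hst.1, hvs.ne.symm, hvt.ne.symm, hsm, htm, hvm]
  · simp only [interior_edge]
    simp [hpq, hpr, hqr, hC'D.mono hI hpD, hC'D.mono hI hqD, hC'D.mono hI hrD]
  · simp only [interior_edge]
    intro I hI'
    simp only [List.mem_cons, List.not_mem_nil, or_false] at hI'
    rcases hI' with rfl | rfl | rfl | rfl | rfl | rfl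
    · exact hCx
    · simp
    · exact hDx p hpD
    · simp
    · exact hDx q hqD
    · exact hDx r hrD
end

section
/- Let G be a biconnected series-parallel simple graph with no transitive edges, let (s,t) be a separation pair of G, and let G' be a light component of G with respect to (s,t). Then the set of internal vertices of G' adjacent to s is an independent set of G, and the set of internal vertices of G' adjacent to t is an independent set of G. -/
open SimpleGraph

variable {V : Type*}

/-- Rerouting step: if two legs of a spider meet outside the centre, a shorter spider exists. -/
lemma spider_shrink (G : SimpleGraph V) {a b c z w : V} (p : G.Walk z a) (q : G.Walk z b)
    (r : G.Walk z c) (hp : p.IsPath)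
    (hpb : b ∉ p.support) (hpc : c ∉ p.support) (hqa : a ∉ q.support)
    (hqc : c ∉ q.support) (hra : a ∉ r.support) (hrb : b ∉ r.support)
    (hwp : w ∈ p.support) (hwq : w ∈ q.support) (hwz : w ≠ z) :
    ∃ (p' : G.Walk w a) (q' : G.Walk w b) (r' : G.Walk w c),
      b ∉ p'.support ∧ c ∉ p'.support ∧ a ∉ q'.support ∧ c ∉ q'.support ∧
      a ∉ r'.support ∧ b ∉ r'.support ∧
      p'.length + q'.length + r'.length < p.length + q.length + r.length := by
  classical
  have lp := congrArg Walk.length (p.take_spec hwp)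
  have lq := congrArg Walk.length (q.take_spec hwq)
  rw [Walk.length_append] at lp lq
  have hpos : 0 < (q.takeUntil w hwq).length := by
    rcases Nat.eq_zero_or_pos (q.takeUntil w hwq).length with h | h
    · exact absurd (Walk.eq_of_length_eq_zero h).symm hwz
    · exact h
  have hpa : ∀ v, v ∈ (p.dropUntil w hwp).support → v ∈ p.support :=
    fun v hv => p.support_dropUntil_subset_support hwp hv
  have hqd : ∀ v, v ∈ (q.dropUntil w hwq).support → v ∈ q.support :=
    fun v hv => q.support_dropUntil_subset_support hwq hv
  have hpt : ∀ v, v ∈ (p.takeUntil w hwp).support → v ∈ p.support :=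
    fun v hv => p.support_takeUntil_subset_support hwp hv
  have haw : a ≠ w := fun e => hqa (e ▸ hwq)
  refine ⟨p.dropUntil w hwp, q.dropUntil w hwq, (p.takeUntil w hwp).reverse.append r,
    fun h => hpb (hpa _ h), fun h => hpc (hpa _ h), fun h => hqa (hqd _ h),
    fun h => hqc (hqd _ h), ?_, ?_, ?_⟩
  · rw [Walk.mem_support_append_iff, Walk.support_reverse, List.mem_reverse]
    rintro (h | h)
    · exact Walk.endpoint_notMem_support_takeUntil hp hwp haw h
    · exact hra h
  · rw [Walk.mem_support_append_iff, Walk.support_reverse, List.mem_reverse]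
    rintro (h | h)
    · exact hpb (hpt _ h)
    · exact hrb h
  · rw [Walk.length_append, Walk.length_reverse]
    omega

lemma interiorSet_edge {G : SimpleGraph V} {a b : V} (h : G.Adj a b) :
    interiorSet h.toWalk = ∅ := by
  ext x
  simp only [interiorSet, Set.mem_ofPred_eq, Set.mem_empty_iff_false, iff_false]
  rintro ⟨h1, h2, h3⟩
  simp at h1
  tauto

/-- A triangle together with a spider attached to it yields a subdivision of `K₄`. -/
lemma k4_of_spider (G : SimpleGraph V) {a b c : V} (hab : G.Adj a b) (hac : G.Adj a c)
    (hbc : G.Adj b c) (n : ℕ) : ∀ (z : V) (p : G.Walk z a) (q : G.Walk z b) (r : G.Walk z c),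
      b ∉ p.support → c ∉ p.support → a ∉ q.support → c ∉ q.support →
      a ∉ r.support → b ∉ r.support → p.length + q.length + r.length = n →
      ContainsK4Subdivision G := by
  classical
  induction n using Nat.strong_induction_on with
  | _ n ih =>
  intro z p₀ q₀ r₀ hpb hpc hqa hqc hra hrb hn
  have sp := p₀.support_bypass_subset_support
  have sq := q₀.support_bypass_subset_support
  have sr := r₀.support_bypass_subset_support
  have lp := p₀.length_bypass_le_length
  have lq := q₀.length_bypass_le_length
  have lr := r₀.length_bypass_le_length
  have ip := p₀.bypass_isPath
  have iq := q₀.bypass_isPath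
  have ir := r₀.bypass_isPath
  replace hpb := fun h => hpb (sp h)
  replace hpc := fun h => hpc (sp h)
  replace hqa := fun h => hqa (sq h)
  replace hqc := fun h => hqc (sq h)
  replace hra := fun h => hra (sr h)
  replace hrb := fun h => hrb (sr h)
  generalize p₀.bypass = p at *
  generalize q₀.bypass = q at *
  generalize r₀.bypass = r at *
  by_cases h1 : ∃ w, w ∈ p.support ∧ w ∈ q.support ∧ w ≠ z
  · obtain ⟨w, hw1, hw2, hwz⟩ := h1
    obtain ⟨p', q', r', k1, k2, k3, k4, k5, k6, hl⟩ :=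
      spider_shrink G p q r ip hpb hpc hqa hqc hra hrb hw1 hw2 hwz
    exact ih _ (by omega) w p' q' r' k1 k2 k3 k4 k5 k6 rfl
  by_cases h2 : ∃ w, w ∈ p.support ∧ w ∈ r.support ∧ w ≠ z
  · obtain ⟨w, hw1, hw2, hwz⟩ := h2
    obtain ⟨p', r', q', k1, k2, k3, k4, k5, k6, hl⟩ :=
      spider_shrink G p r q ip hpc hpb hra hrb hqa hqc hw1 hw2 hwz
    exact ih _ (by omega) w p' q' r' k2 k1 k5 k6 k3 k4 rfl
  by_cases h3 : ∃ w, w ∈ q.support ∧ w ∈ r.support ∧ w ≠ z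
  · obtain ⟨w, hw1, hw2, hwz⟩ := h3
    obtain ⟨q', r', p', k1, k2, k3, k4, k5, k6, hl⟩ :=
      spider_shrink G q r p iq hqc hqa hrb hra hpb hpc hw1 hw2 hwz
    exact ih _ (by omega) w p' q' r' k5 k6 k2 k1 k4 k3 rfl
  have hza : z ≠ a := fun e => hqa (e ▸ q.start_mem_support)
  have hzb : z ≠ b := fun e => hpb (e ▸ p.start_mem_support)
  have hzc : z ≠ c := fun e => hpc (e ▸ p.start_mem_support)
  refine ⟨z, a, b, c, p, q, r, hab.toWalk, hac.toWalk, hbc.toWalk, ?_, ip, iq, ir,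
    ?_, ?_, ?_, ?_, ?_⟩
  · have := hab.ne
    have := hac.ne
    have := hbc.ne
    simp [*]
  · simp [hab.ne]
  · simp [hac.ne]
  · simp [hbc.ne]
  · have d1 : Disjoint (interiorSet p) (interiorSet q) :=
      Set.disjoint_left.2 fun x hx hy => h1 ⟨x, hx.1, hy.1, hx.2.1⟩
    have d2 : Disjoint (interiorSet p) (interiorSet r) :=
      Set.disjoint_left.2 fun x hx hy => h2 ⟨x, hx.1, hy.1, hx.2.1⟩
    have d3 : Disjoint (interiorSet q) (interiorSet r) :=
      Set.disjoint_left.2 fun x hx hy => h3 ⟨x, hx.1, hy.1, hx.2.1⟩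
    simp [interiorSet_edge, d1, d2, d3]
  · intro I hI x hx
    simp only [interiorSet_edge, List.mem_cons, List.not_mem_nil, or_false] at hI
    simp only [Set.mem_insert_iff, Set.mem_singleton_iff]
    rcases hI with rfl | rfl | rfl | rfl | rfl | rfl
    · obtain ⟨x1, x2, x3⟩ := hx
      rintro (rfl | rfl | rfl | rfl) <;> contradiction
    · obtain ⟨x1, x2, x3⟩ := hx
      rintro (rfl | rfl | rfl | rfl) <;> contradiction
    · obtain ⟨x1, x2, x3⟩ := hx
      rintro (rfl | rfl | rfl | rfl) <;> contradiction
    all_goals exact absurd hx (Set.notMem_empty x)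

/-- The ends of an edge are not a separation pair, so other vertices are linked around it. -/
lemma walk_avoiding (G : SimpleGraph V) (hTr : NoTransitiveEdges G) {a b c z : V}
    (hbc : G.Adj b c) (hab : a ≠ b) (hac : a ≠ c) (hzb : z ≠ b) (hzc : z ≠ c) :
    ∃ p : G.Walk z a, b ∉ p.support ∧ c ∉ p.support := by
  have h : (G.induce {v | v ≠ b ∧ v ≠ c}).Preconnected := by
    by_contra h
    exact hTr b c ⟨hbc.ne, h⟩ hbc
  obtain ⟨w⟩ := h ⟨z, hzb, hzc⟩ ⟨a, hab, hac⟩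
  have key : ∀ x ∈ (w.map (Embedding.induce {v | v ≠ b ∧ v ≠ c}).toHom).support,
      x ≠ b ∧ x ≠ c := by
    intro x hm
    rw [Walk.support_map, List.mem_map] at hm
    obtain ⟨v, -, hv⟩ := hm
    have := v.2
    subst hv
    exact this
  exact ⟨w.map (Embedding.induce {v | v ≠ b ∧ v ≠ c}).toHom,
    fun hm => (key b hm).1 rfl, fun hm => (key c hm).2 rfl⟩

/-- No triangle misses a vertex. -/
lemma no_triangle (G : SimpleGraph V) (hSP : ¬ ContainsK4Subdivision G)
    (hTr : NoTransitiveEdges G) {a b c z : V} (hab : G.Adj a b) (hac : G.Adj a c)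
    (hbc : G.Adj b c) (hza : z ≠ a) (hzb : z ≠ b) (hzc : z ≠ c) : False := by
  obtain ⟨p, p1, p2⟩ := walk_avoiding G hTr hbc hab.ne hac.ne hzb hzc
  obtain ⟨q, q1, q2⟩ := walk_avoiding G hTr hac hab.ne.symm hbc.ne hza hzc
  obtain ⟨r, r1, r2⟩ := walk_avoiding G hTr hab hac.ne.symm hbc.ne.symm hza hzb
  exact hSP (k4_of_spider G hab hac hbc _ z p q r p1 p2 q1 q2 r1 r2 rfl)

/-- In a biconnected series-parallel simple graph without transitive edges, in a light
component w.r.t. a separation pair `(s, t)`, the internal vertices adjacent to `s` form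
an independent set, as do the internal vertices adjacent to `t`. -/
theorem stmt6 [Fintype V] (G : SimpleGraph V)
    (hBi : Biconnected G) (hSP : ¬ ContainsK4Subdivision G)
    (hTr : NoTransitiveEdges G)
    (s t : V) (hst : SepPair G s t)
    (C : Set V) (hC : IsCompAt G s t C) (hL : Light G s t C) :
    ({v ∈ C | G.Adj v s}).Pairwise (fun x y => ¬ G.Adj x y) ∧
    ({v ∈ C | G.Adj v t}).Pairwise (fun x y => ¬ G.Adj x y) := by
  constructor
  · rintro x ⟨hx, hxs⟩ y ⟨hy, hys⟩ - hxy
    exact no_triangle G hSP hTr hxs.symm hys.symm hxy hst.1.symm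
      (hC.2.1 hx).2.symm (hC.2.1 hy).2.symm
  · rintro x ⟨hx, hxt⟩ y ⟨hy, hyt⟩ - hxy
    exact no_triangle G hSP hTr hxt.symm hyt.symm hxy hst.1
      (hC.2.1 hx).1.symm (hC.2.1 hy).1.symm
end

section
/- Let G be a biconnected simple graph, let (u,v) be a separation pair of G, and let G' be a component of G with respect to (u,v). If G' contains an internal vertex w adjacent to neither u nor v, then there is a path from u to v all of whose vertices belong to G', passing through w, whose length (number of edges) is at least 4. -/
open SimpleGraph

variable {V : Type*}

theorem aux_walk_avoid (G : SimpleGraph V) (y a t : V)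
    (h : (G.induce {v | v ≠ y}).Connected) (ha : a ≠ y) (ht : t ≠ y) :
    ∃ p : G.Walk a t, y ∉ p.support := by
  obtain ⟨p⟩ := h.preconnected ⟨a, ha⟩ ⟨t, ht⟩
  refine ⟨p.map (Embedding.induce {v | v ≠ y}).toHom, ?_⟩
  intro hy
  have hy2 := (congrArg (y ∈ ·) (Walk.support_map (Embedding.induce {v | v ≠ y}).toHom p)).mp hy
  obtain ⟨z, -, hz⟩ := List.mem_map.1 hy2
  exact z.2 hz

theorem aux_first_hit (G : SimpleGraph V) (u v : V) (C : Set V)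
    (hcl : ∀ a ∈ C, ∀ b, b ≠ u ∧ b ≠ v → G.Adj a b → b ∈ C)
    (A : Set V) (hu : u ∈ A) (hv : v ∈ A) (a t : V) (p : G.Walk a t) :
    t ∈ A → (a ∈ A ∨ a ∈ C) → ∃ (z : V) (r : G.Walk a z), z ∈ A ∧
      (∀ s ∈ r.support, s ∈ p.support) ∧ (∀ s ∈ r.support, s ∈ A → s = z) ∧
      (∀ s ∈ r.support, s = z ∨ s ∈ C) := by
  induction p with
  | nil =>
    intro ht _
    exact ⟨_, Walk.nil, ht, by simp, by simp, by simp⟩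
  | @cons a b t h p ih =>
    intro ht ha
    by_cases haA : a ∈ A
    · exact ⟨_, Walk.nil, haA, by simp, by simp, by simp⟩
    · have haC := ha.resolve_left haA
      have hb : b ∈ A ∨ b ∈ C := by
        by_cases h1 : b = u
        · left; rwa [h1]
        by_cases h2 : b = v
        · left; rwa [h2]
        exact Or.inr (hcl a haC b ⟨h1, h2⟩ h)
      obtain ⟨z, r, hz, h1, h2, h3⟩ := ih ht hb
      refine ⟨z, Walk.cons h r, hz, ?_, ?_, ?_⟩
      all_goals
        intro s hs
        rw [Walk.support_cons, List.mem_cons] at hs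
        rcases hs with rfl | hs
      · simp
      · simp [h1 s hs]
      · intro h'; exact absurd h' haA
      · exact h2 s hs
      · exact Or.inr haC
      · exact h3 s hs

theorem aux_reroute_s10 (G : SimpleGraph V) {u v x y z : V} (p1 : G.Walk u y) (p2 : G.Walk y z)
    (p3 : G.Walk z v) (hp : (p1.append (p2.append p3)).IsPath) (hyz : z ≠ y) (h : G.Adj y x)
    (r : G.Walk x z) (hr : r.IsPath)
    (hA : ∀ s ∈ r.support, s ∈ (p1.append (p2.append p3)).support → s = z) :
    (p1.append (Walk.cons h (r.append p3))).IsPath := by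
  rw [Walk.isPath_def] at hp hr ⊢
  rw [Walk.support_append, Walk.support_append] at hp
  simp only [Walk.mem_support_append_iff] at hA
  rw [Walk.support_append, Walk.support_cons, List.tail_cons, Walk.support_append]
  have e2 : p2.support = y :: p2.support.tail := (Walk.cons_tail_support p2).symm
  have e3 : p3.support = z :: p3.support.tail := (Walk.cons_tail_support p3).symm
  have hz2 : z ∈ p2.support.tail := by
    have := p2.end_mem_support
    rw [e2, List.mem_cons] at this
    exact this.resolve_left hyz
  rw [e2] at hp
  simp only [List.cons_append, List.tail_cons, List.nodup_append, List.mem_append] at hp ⊢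
  obtain ⟨hp1, ⟨hp2, hp3, h23⟩, hd⟩ := hp
  refine ⟨hp1, ⟨hr, hp3, ?_⟩, ?_⟩
  · rintro a ha b hb rfl
    have : a = z := hA a ha (Or.inr (Or.inr (List.mem_of_mem_tail hb)))
    subst this
    exact h23 a hz2 a hb rfl
  · rintro a ha b hb rfl
    rcases hb with hb | hb
    · have : a = z := hA a hb (Or.inl ha)
      subst this
      exact hd a ha a (Or.inl hz2) rfl
    · exact hd a ha a (Or.inr hb) rfl

theorem aux_insert (G : SimpleGraph V) (S : Set V) {u v x y z : V} (p : G.Walk u v)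
    (hp : p.IsPath) (hS : ∀ s ∈ p.support, s ∈ S) (hy : y ∈ p.support) (hyz : z ≠ y)
    (h : G.Adj y x) (r : G.Walk x z) (hr : r.IsPath) (hrS : ∀ s ∈ r.support, s ∈ S)
    (hz : z ∈ p.support) (hA : ∀ s ∈ r.support, s ∈ p.support → s = z) :
    ∃ q : G.Walk u v, q.IsPath ∧ (∀ s ∈ q.support, s ∈ S) ∧ x ∈ q.support := by
  classical
  have key : ∀ {u v : V} (p : G.Walk u v) (hp : p.IsPath) (hS : ∀ s ∈ p.support, s ∈ S)
      (p1 : G.Walk u y) (p2 : G.Walk y z) (p3 : G.Walk z v)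
      (e : p1.append (p2.append p3) = p)
      (hA : ∀ s ∈ r.support, s ∈ p.support → s = z),
      ∃ q : G.Walk u v, q.IsPath ∧ (∀ s ∈ q.support, s ∈ S) ∧ x ∈ q.support := by
    intro u v p hp hS p1 p2 p3 e hA
    subst e
    refine ⟨_, aux_reroute_s10 G p1 p2 p3 hp hyz h r hr hA, ?_, ?_⟩
    · intro s hs
      simp only [Walk.mem_support_append_iff] at hS
      rw [Walk.mem_support_append_iff, Walk.support_cons, List.mem_cons,
        Walk.mem_support_append_iff] at hs
      rcases hs with hs | rfl | hs | hs
      · exact hS s (Or.inl hs)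
      · exact hS _ (Or.inl p1.end_mem_support)
      · exact hrS s hs
      · exact hS s (Or.inr (Or.inr hs))
    · simp
  have hz' := hz
  rw [← Walk.take_spec p hy, Walk.mem_support_append_iff] at hz'
  rcases hz' with hz' | hz'
  · obtain ⟨q, h1, h2, h3⟩ := key p.reverse hp.reverse (by simpa using hS)
      (p.dropUntil y hy).reverse ((p.takeUntil y hy).dropUntil z hz').reverse
      ((p.takeUntil y hy).takeUntil z hz').reverse
      (by rw [← Walk.reverse_append, ← Walk.reverse_append, Walk.take_spec, Walk.take_spec])
      (by simpa using hA)
    exact ⟨q.reverse, h1.reverse, by simpa using h2, by simpa using h3⟩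
  · exact key p hp hS (p.takeUntil y hy) ((p.dropUntil y hy).takeUntil z hz')
      ((p.dropUntil y hy).dropUntil z hz') (by rw [Walk.take_spec, Walk.take_spec]) hA

theorem aux_long (G : SimpleGraph V) {a b : V} (p : G.Walk a b) (hne : a ≠ b)
    (h : ¬ G.Adj a b) : 2 ≤ p.length := by
  by_contra hlt
  have : p.length = 0 ∨ p.length = 1 := by omega
  rcases this with h0 | h1
  · exact hne (Walk.eq_of_length_eq_zero h0)
  · exact h (Walk.adj_of_length_eq_one h1)

/-- In a biconnected simple graph, if a component w.r.t. a separation pair `(u, v)`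
contains an internal vertex `w` adjacent to neither `u` nor `v`, then the component
contains a path from `u` to `v` through `w` of length at least four. -/
theorem stmt10 [Fintype V] (G : SimpleGraph V) (hBi : Biconnected G)
    (u v : V) (huv : SepPair G u v)
    (C : Set V) (hC : IsCompAt G u v C)
    (w : V) (hw : w ∈ C) (hwu : ¬ G.Adj w u) (hwv : ¬ G.Adj w v) :
    ∃ (q : G.Walk u v), q.IsPath ∧
      (∀ x ∈ q.support, x = u ∨ x = v ∨ x ∈ C) ∧ w ∈ q.support ∧ 4 ≤ q.length := by
  classical
  obtain ⟨-, -, hcut⟩ := hBi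
  obtain ⟨huv, -⟩ := huv
  obtain ⟨-, hCD, -, hcl0⟩ := hC
  have hcl : ∀ a ∈ C, ∀ b, b ≠ u ∧ b ≠ v → G.Adj a b → b ∈ C :=
    fun a ha b hb hab => hcl0 a ha b hb hab
  have hwu' : w ≠ u := (hCD hw).1
  have hwv' : w ≠ v := (hCD hw).2
  -- paths from `w` to each pole inside the component
  have hr1 : ∃ r : G.Walk w u, ∀ s ∈ r.support, s = u ∨ s = v ∨ s ∈ C := by
    obtain ⟨p, hp⟩ := aux_walk_avoid G v w u (hcut v) hwv' huv
    obtain ⟨z, r, hz, h1, h2, h3⟩ := aux_first_hit G u v C hcl {u, v} (by simp) (by simp) w u p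
      (by simp) (Or.inr hw)
    have hzu : z = u := by
      rcases hz with hz | hz
      · exact hz
      · rw [Set.mem_singleton_iff] at hz
        exact absurd (hz ▸ h1 z r.end_mem_support) hp
    subst hzu
    exact ⟨r, fun s hs => (h3 s hs).imp id Or.inr⟩
  have hr2 : ∃ r : G.Walk w v, ∀ s ∈ r.support, s = u ∨ s = v ∨ s ∈ C := by
    obtain ⟨p, hp⟩ := aux_walk_avoid G u w v (hcut u) hwu' huv.symm
    obtain ⟨z, r, hz, h1, h2, h3⟩ := aux_first_hit G u v C hcl {u, v} (by simp) (by simp) w v p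
      (by simp) (Or.inr hw)
    have hzv : z = v := by
      rcases hz with hz | hz
      · exact absurd (hz ▸ h1 z r.end_mem_support) hp
      · exact hz
    subst hzv
    exact ⟨r, fun s hs => Or.inr (h3 s hs)⟩
  obtain ⟨r1, hr1⟩ := hr1
  obtain ⟨r2, hr2⟩ := hr2
  have step : ∀ (y x : V), G.Adj y x → (x = u ∨ x = v ∨ x ∈ C) →
      (∃ q : G.Walk u v, q.IsPath ∧ (∀ s ∈ q.support, s ∈ {s | s = u ∨ s = v ∨ s ∈ C}) ∧
        y ∈ q.support) →
      (∃ q : G.Walk u v, q.IsPath ∧ (∀ s ∈ q.support, s ∈ {s | s = u ∨ s = v ∨ s ∈ C}) ∧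
        x ∈ q.support) := by
    rintro y x hyx hxS ⟨q, hq, hqS, hyq⟩
    by_cases hx : x ∈ q.support
    · exact ⟨q, hq, hqS, hx⟩
    have hxC : x ∈ C := by
      rcases hxS with rfl | rfl | h
      · exact absurd q.start_mem_support hx
      · exact absurd q.end_mem_support hx
      · exact h
    obtain ⟨t, ht, hty⟩ : ∃ t, t ∈ q.support ∧ t ≠ y := by
      by_cases h : u = y
      · exact ⟨v, q.end_mem_support, fun h' => huv (h.trans h'.symm)⟩
      · exact ⟨u, q.start_mem_support, h⟩
    obtain ⟨p, hp⟩ := aux_walk_avoid G y x t (hcut y) hyx.ne' hty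
    obtain ⟨z, r, hz, h1, h2, h3⟩ := aux_first_hit G u v C hcl {s | s ∈ q.support}
      q.start_mem_support q.end_mem_support x t p ht (Or.inr hxC)
    have hsub : ∀ s ∈ r.bypass.support, s ∈ r.support :=
      fun s hs => Walk.support_bypass_subset_support r hs
    refine aux_insert G _ q hq hqS hyq ?_ hyx r.bypass (Walk.bypass_isPath r) ?_ hz
      (fun s hs => h2 s (hsub s hs))
    · rintro rfl
      exact hp (h1 _ r.end_mem_support)
    · intro s hs
      rcases h3 s (hsub s hs) with rfl | h
      · exact hqS _ hz
      · exact Or.inr (Or.inr h)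
  have walkstep : ∀ (y x : V) (p : G.Walk y x),
      (∀ s ∈ p.support, s = u ∨ s = v ∨ s ∈ C) →
      (∃ q : G.Walk u v, q.IsPath ∧ (∀ s ∈ q.support, s ∈ {s | s = u ∨ s = v ∨ s ∈ C}) ∧
        y ∈ q.support) →
      (∃ q : G.Walk u v, q.IsPath ∧ (∀ s ∈ q.support, s ∈ {s | s = u ∨ s = v ∨ s ∈ C}) ∧
        x ∈ q.support) := by
    intro y x p
    induction p with
    | nil => exact fun _ h => h
    | cons h p ih =>
      intro hS hq
      refine ih (fun s hs => hS s (by simp [hs])) (step _ _ h (hS _ (by simp)) hq)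
  obtain ⟨q, hq, hqS, hwq⟩ := walkstep u w r1.reverse (by simpa using hr1)
    ⟨(r1.reverse.append r2).bypass, Walk.bypass_isPath _, by
      intro s hs
      have := Walk.support_bypass_subset_support _ hs
      rw [Walk.mem_support_append_iff, Walk.support_reverse, List.mem_reverse] at this
      exact this.elim (hr1 s) (hr2 s), Walk.start_mem_support _⟩
  refine ⟨q, hq, hqS, hwq, ?_⟩
  have h1 := aux_long G (q.takeUntil w hwq) hwu'.symm (fun h => hwu h.symm)
  have h2 := aux_long G (q.dropUntil w hwq) hwv' hwv
  have h3 := congrArg Walk.length (Walk.take_spec q hwq)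
  rw [Walk.length_append] at h3
  omega
end
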